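/- There is a unique basis B* = {b(A) : A ∈ M_n(ℤ≥0)} of the ℤ[q]-module L* such that: (1) bar(b(A)) = b(A) for all A; (2) b(A) = x(A) + Σ_{B<A} h_{BA} x(B) where h_{BA} ∈ qℤ[q]. -/

import Mathlib

open scoped TensorProduct

set_option synthInstance.maxHeartbeats 1000000
set_option maxHeartbeats 1000000

noncomputable section

/-- The base field `K = ℚ(q)`. -/
abbrev Kq : Type := RatFunc ℚ

/-- The indeterminate `q ∈ ℚ(q)`. -/
noncomputable def qq : Kq := RatFunc.X

/-- Matrices with nonnegative integer entries. -/
abbrev Mat (n : ℕ) := Matrix (Fin n) (Fin n) ℕ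

/-- The defining relations of the quantum matrix algebra `O_q(M(n))`. -/
inductive OqRel (n : ℕ) :
    FreeAlgebra Kq (Fin n × Fin n) → FreeAlgebra Kq (Fin n × Fin n) → Prop
  | rel_row {i j k : Fin n} (h : j < k) :
      OqRel n (FreeAlgebra.ι Kq (i, j) * FreeAlgebra.ι Kq (i, k))
        ((qq ^ 2) • (FreeAlgebra.ι Kq (i, k) * FreeAlgebra.ι Kq (i, j)))
  | rel_col {i k j : Fin n} (h : i < k) :
      OqRel n (FreeAlgebra.ι Kq (i, j) * FreeAlgebra.ι Kq (k, j))
        ((qq ^ 2) • (FreeAlgebra.ι Kq (k, j) * FreeAlgebra.ι Kq (i, j)))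
  | rel_anti {i j s t : Fin n} (h1 : s < i) (h2 : j < t) :
      OqRel n (FreeAlgebra.ι Kq (i, j) * FreeAlgebra.ι Kq (s, t))
        (FreeAlgebra.ι Kq (s, t) * FreeAlgebra.ι Kq (i, j))
  | rel_diag {i j s t : Fin n} (h1 : i < s) (h2 : j < t) :
      OqRel n (FreeAlgebra.ι Kq (i, j) * FreeAlgebra.ι Kq (s, t))
        (FreeAlgebra.ι Kq (s, t) * FreeAlgebra.ι Kq (i, j)
          + (qq ^ 2 - qq⁻¹ ^ 2) • (FreeAlgebra.ι Kq (i, t) * FreeAlgebra.ι Kq (s, j)))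

/-- The quantum matrix algebra `O_q(M(n))`. -/
abbrev Oq (n : ℕ) := RingQuot (OqRel n)

/-- The generator `x_{ij}` of `O_q(M(n))`. -/
noncomputable def xgen (n : ℕ) (i j : Fin n) : Oq n :=
  RingQuot.mkAlgHom Kq (OqRel n) (FreeAlgebra.ι Kq (i, j))

/-- The lexicographically ordered monomial `x^A`. -/
noncomputable def xMon (n : ℕ) (A : Mat n) : Oq n :=
  ((List.finRange n).map fun i =>
    ((List.finRange n).map fun j => xgen n i j ^ A i j).prod).prod
/-- The exponent appearing in `E(A)` and `D(A)`. -/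
def eExp (n : ℕ) (A : Mat n) : ℕ :=
  ∑ i, ∑ j, ∑ k ∈ Finset.univ.filter (fun k => k < j), (A i j * A i k + A j i * A k i)

/-- The modified monomial `x(A) = D(A) x^A`. -/
noncomputable def xMod (n : ℕ) (A : Mat n) : Oq n := (qq ^ (-(eExp n A : ℤ))) • xMon n A

/-- `matStep M M'` : `M'` is obtained from `M` by a single 2×2 submatrix transformation. -/
def matStep (n : ℕ) (M M' : Mat n) : Prop :=
  ∃ i s j t : Fin n, i < s ∧ j < t ∧ 1 ≤ M i j ∧ 1 ≤ M s t ∧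
    M' i j = M i j - 1 ∧ M' s t = M s t - 1 ∧ M' i t = M i t + 1 ∧ M' s j = M s j + 1 ∧
    ∀ u v : Fin n,
      ¬((u = i ∧ v = j) ∨ (u = s ∧ v = t) ∨ (u = i ∧ v = t) ∨ (u = s ∧ v = j)) →
        M' u v = M u v

/-- `matLT B A` : `B < A`, i.e. `B` is obtained from `A` by a nonempty sequence of
2×2 submatrix transformations. -/
def matLT (n : ℕ) (B A : Mat n) : Prop := Relation.TransGen (matStep n) A B

/-- Membership in `ℤ[q] ⊆ ℚ(q)`. -/
def inZq (c : Kq) : Prop := c ∈ Subring.closure ({qq} : Set Kq)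

/-- Membership in `qℤ[q] ⊆ ℚ(q)`. -/
def inQZq (c : Kq) : Prop := ∃ d : Kq, inZq d ∧ c = qq * d

/-- Membership in `ℤ[q, q⁻¹] ⊆ ℚ(q)`. -/
def inZLaurent (c : Kq) : Prop := c ∈ Subring.closure ({qq, qq⁻¹} : Set Kq)

/-- `bar` is the bar involution: a `ℚ`-algebra anti-automorphism fixing the `x_{ij}`
and semilinear with respect to `q ↦ q⁻¹`. -/
def IsBar (n : ℕ) (bar : Oq n → Oq n) : Prop :=
  Function.Bijective bar ∧
  (∀ a b : Oq n, bar (a + b) = bar a + bar b) ∧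
  (∀ (r : ℚ) (a : Oq n), bar ((r : Kq) • a) = (r : Kq) • bar a) ∧
  (∀ a b : Oq n, bar (a * b) = bar b * bar a) ∧
  bar 1 = 1 ∧
  (∀ i j, bar (xgen n i j) = xgen n i j) ∧
  (∀ a : Oq n, bar (qq • a) = qq⁻¹ • bar a)

/-- Membership in the `ℤ[q]`-lattice `L* = ⊕_A ℤ[q]·x(A)`. -/
def memLstar (n : ℕ) (v : Oq n) : Prop :=
  ∃ (F : Finset (Mat n)) (h : Mat n → Kq),
    (∀ A ∈ F, inZq (h A)) ∧ v = ∑ A ∈ F, h A • xMod n A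

/-- `b` is the dual canonical basis of `O_q(M(n))` relative to the bar involution `bar`:
each `b A` is bar-invariant, is `x(A)` plus a `qℤ[q]`-combination of `x(B)` with `B < A`,
and the family is a `ℤ[q]`-basis of `L*`. -/
def IsDCB (n : ℕ) (bar : Oq n → Oq n) (b : Mat n → Oq n) : Prop :=
  (∀ A, bar (b A) = b A) ∧
  (∀ A, ∃ (F : Finset (Mat n)) (h : Mat n → Kq),
      (∀ B ∈ F, matLT n B A ∧ inQZq (h B)) ∧
      b A = xMod n A + ∑ B ∈ F, h B • xMod n B) ∧
  (∀ v, memLstar n v → ∃ (F : Finset (Mat n)) (h : Mat n → Kq),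
      (∀ A ∈ F, inZq (h A)) ∧ v = ∑ A ∈ F, h A • b A) ∧
  (∀ (F : Finset (Mat n)) (h : Mat n → Kq), (∀ A ∈ F, inZq (h A)) →
      ∑ A ∈ F, h A • b A = 0 → ∀ A ∈ F, h A = 0)

/-- The quadratic relations of the quantum matrix algebra, for a family `P i j s t` playing the
role of the product `x_{ij} x_{st}`; here `a = q²` and `b = q⁻²`. -/
structure IsQuad {k R C Z : Type*} [CommRing k] [LinearOrder R] [LinearOrder C]
    [AddCommGroup Z] [Module k Z] (a b : k) (P : R → C → R → C → Z) : Prop where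
  row : ∀ i j l, j < l → P i j i l = a • P i l i j
  col : ∀ i s j, i < s → P i j s j = a • P s j i j
  anti : ∀ i j s t, s < i → j < t → P i j s t = P s t i j
  diag : ∀ i j s t, i < s → j < t → P i j s t = P s t i j + (a - b) • P i t s j

section Quad

variable {k R C D U V Z : Type*} [CommRing k] [LinearOrder R] [LinearOrder C] [LinearOrder D]
  [AddCommGroup U] [Module k U] [AddCommGroup V] [Module k V] [AddCommGroup Z] [Module k Z]
  {a b : k}

theorem sum_sum_eq_of_symm [Fintype C] {f g : C → C → Z} (hd : ∀ l, f l l = g l l)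
    (ho : ∀ l m, l < m → f l m + f m l = g l m + g m l) :
    ∑ l, ∑ m, f l m = ∑ l, ∑ m, g l m := by
  rw [← Fintype.sum_prod_type', ← Fintype.sum_prod_type', ← sub_eq_zero, ← Finset.sum_sub_distrib]
  refine Finset.sum_involution (fun x _ => x.swap) ?_ ?_ (fun _ _ => Finset.mem_univ _)
    (fun _ _ => Prod.swap_swap _)
  · rintro ⟨l, m⟩ -
    rcases lt_trichotomy l m with h | rfl | h
    · have := ho l m h
      simp only [Prod.fst_swap, Prod.snd_swap]
      rw [sub_add_sub_comm, this, sub_self]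
    · simp [hd]
    · have := ho m l h
      simp only [Prod.fst_swap, Prod.snd_swap]
      rw [sub_add_sub_comm, add_comm, this, add_comm (g m l), sub_self]
  · rintro ⟨l, m⟩ - hne heq
    simp only [Prod.swap_prod_mk, Prod.mk.injEq] at heq
    obtain ⟨rfl, -⟩ := heq
    exact hne (by simp [hd])

/-- The coproduct of quantum matrices, at the level of quadratic relations. -/
theorem IsQuad.comp [Fintype C] (hab : a * b = 1) {P : R → C → R → C → U} {Q : C → D → C → D → V}
    (hP : IsQuad a b P) (hQ : IsQuad a b Q) (β : U →ₗ[k] V →ₗ[k] Z) :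
    IsQuad a b (fun i j s t => ∑ l, ∑ m, β (P i l s m) (Q l j m t)) where
  row i j t h := by
    simp only [Finset.smul_sum]
    apply sum_sum_eq_of_symm
    · intro l
      rw [hQ.row l j t h, map_smul]
    · intro l m hlm
      rw [hP.row i l m hlm, hQ.diag l j m t hlm h, hQ.anti m j l t hlm h]
      simp only [map_smul, map_add, LinearMap.smul_apply]
      linear_combination (norm := module)
        (-hab) • (β (P i m i l) (Q l t m j))
  col i s j h := by
    simp only [Finset.smul_sum]
    apply sum_sum_eq_of_symm
    · intro l
      rw [hP.col i s l h, map_smul, LinearMap.smul_apply]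
    · intro l m hlm
      rw [hQ.col l m j hlm, hP.diag i l s m h hlm, hP.anti s l i m h hlm]
      simp only [map_smul, map_add, LinearMap.smul_apply, LinearMap.add_apply]
      linear_combination (norm := module)
        (-hab) • (β (P i m s l) (Q m j l j))
  anti i j s t h1 h2 := by
    apply sum_sum_eq_of_symm
    · intro l
      rw [hP.col s i l h1, hQ.row l j t h2]
      simp only [map_smul, LinearMap.smul_apply]
    · intro l m hlm
      rw [hP.anti i l s m h1 hlm, hP.diag s l i m h1 hlm, hQ.diag l j m t hlm h2,
        hQ.anti m j l t hlm h2]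
      simp only [map_smul, map_add, LinearMap.smul_apply, LinearMap.add_apply]
      module
  diag i j s t h1 h2 := by
    rw [Finset.smul_sum, ← Finset.sum_add_distrib]
    simp only [Finset.smul_sum, ← Finset.sum_add_distrib]
    apply sum_sum_eq_of_symm
    · intro l
      rw [hP.col i s l h1, hQ.row l j t h2]
      simp only [map_smul, LinearMap.smul_apply]
      linear_combination (norm := module)
        (hab) • (β (P s l i l) (Q l t l j))
    · intro l m hlm
      rw [hP.diag i l s m h1 hlm, hQ.diag l j m t hlm h2, hQ.anti m j l t hlm h2,
        hP.anti s l i m h1 hlm]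
      simp only [map_smul, map_add, LinearMap.smul_apply, LinearMap.add_apply]
      module

theorem IsQuad.map {P : R → C → R → C → U} (hP : IsQuad a b P) (f : U →ₗ[k] V) :
    IsQuad a b (fun i j s t => f (P i j s t)) where
  row i j l h := by rw [hP.row i j l h, map_smul]
  col i s j h := by rw [hP.col i s j h, map_smul]
  anti i j s t h1 h2 := by rw [hP.anti i j s t h1 h2]
  diag i j s t h1 h2 := by rw [hP.diag i j s t h1 h2, map_add, map_smul]

/-- The entries of the `R`-matrix, a representation of quantum matrices by constant matrices. -/
def rMat (C : Type*) [LinearOrder C] (a b : k) (i j : C) : Matrix C C k :=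
  if i = j then 1 + Matrix.single i i (b - 1)
  else if j < i then Matrix.single i j (b - a) else 0

theorem rMat_self (i : C) : rMat C a b i i = 1 + Matrix.single i i (b - 1) := by simp [rMat]

theorem rMat_of_lt {i j : C} (h : j < i) : rMat C a b i j = Matrix.single i j (b - a) := by
  simp [rMat, h, h.ne']

theorem rMat_of_gt {i j : C} (h : i < j) : rMat C a b i j = 0 := by
  simp [rMat, h.not_gt, h.ne]

theorem rMat_isQuad [Fintype C] (hab : a * b = 1) :
    IsQuad a b (fun i j s t : C => rMat C a b i j * rMat C a b s t) where
  row i j l h := by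
    rcases lt_trichotomy i l with hi | rfl | hi
    · simp [rMat_of_gt hi]
    · simp [rMat_self, rMat_of_lt h, mul_add, add_mul, h.ne, ← Matrix.single_add, Matrix.smul_single]
      congr 1
      linear_combination (-hab) * (b - a)
    · simp [rMat_of_lt hi, rMat_of_lt (h.trans hi), (h.trans hi).ne, hi.ne]
  col i s j h := by
    rcases lt_trichotomy j i with hi | rfl | hi
    · simp [rMat_of_lt hi, rMat_of_lt (hi.trans h), hi.ne, (hi.trans h).ne]
    · simp [rMat_self, rMat_of_lt h, mul_add, add_mul, h.ne, ← Matrix.single_add, Matrix.smul_single]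
      congr 1
      linear_combination (-hab) * (b - a)
    · simp [rMat_of_gt hi]
  anti i j s t h1 h2 := by
    rcases lt_trichotomy t s with h | rfl | h
    · simp [rMat_of_lt h, rMat_of_lt (h2.trans (h.trans h1)),
        (h2.trans h).ne, (h.trans h1).ne]
    · simp [rMat_self, rMat_of_lt (h2.trans h1), mul_add, add_mul, h1.ne, h2.ne]
    · simp [rMat_of_gt h]
  diag i j s t h1 h2 := by
    rcases lt_trichotomy j i with h | rfl | h
    · rcases lt_trichotomy s t with h' | rfl | h'
      · simp [rMat_of_gt h', rMat_of_gt (h1.trans h')]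
      · simp [rMat_self, rMat_of_lt h, rMat_of_gt h1, mul_add, add_mul, h2.ne, h1.ne']
      · rcases lt_trichotomy t i with h'' | rfl | h''
        · simp [rMat_of_lt h, rMat_of_lt h', rMat_of_lt h'', rMat_of_lt (h.trans h1),
            (h.trans h1).ne, h''.ne, h'.ne]
        · simp [rMat_of_lt h, rMat_of_lt h', rMat_self, rMat_of_lt (h.trans h1),
            (h.trans h1).ne, h'.ne, add_mul, ← Matrix.single_add, Matrix.smul_single]
          ring_nf
          simp
        · simp [rMat_of_lt h, rMat_of_lt h', rMat_of_gt h'', (h.trans h1).ne, h''.ne']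
    · rcases lt_trichotomy s t with h' | rfl | h'
      · simp [rMat_of_gt h', rMat_of_gt h2]
      · simp [rMat_self, rMat_of_gt h1, mul_add, add_mul, h2.ne, h2.ne']
        abel
      · simp [rMat_self, rMat_of_lt h', rMat_of_gt h2, mul_add, add_mul, h1.ne, h2.ne']
    · simp [rMat_of_gt h, rMat_of_gt (h.trans h2)]

end Quad

section QuadClosure

variable {k R C U : Type*} [CommRing k] [LinearOrder R] [LinearOrder C]
  [AddCommGroup U] [Module k U] {a b : k}

theorem IsQuad.add {P Q : R → C → R → C → U} (hP : IsQuad a b P) (hQ : IsQuad a b Q) :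
    IsQuad a b (fun i j s t => P i j s t + Q i j s t) where
  row i j l h := by rw [hP.row i j l h, hQ.row i j l h, smul_add]
  col i s j h := by rw [hP.col i s j h, hQ.col i s j h, smul_add]
  anti i j s t h1 h2 := by rw [hP.anti i j s t h1 h2, hQ.anti i j s t h1 h2]
  diag i j s t h1 h2 := by
    rw [hP.diag i j s t h1 h2, hQ.diag i j s t h1 h2]
    module

theorem IsQuad.map_algHom {S T : Type*} [Ring S] [Algebra k S] [Ring T] [Algebra k T]
    {X : R → C → S} (hX : IsQuad a b (fun i j s t => X i j * X s t)) (f : S →ₐ[k] T) :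
    IsQuad a b (fun i j s t => f (X i j) * f (X s t)) := by
  simpa using hX.map f.toLinearMap

theorem isQuad_delta (u : U) :
    IsQuad a b (fun i j s t : C => if s = t then if i = j then u else 0 else 0) where
  row i j l h := by
    split_ifs <;> simp_all
  col i s j h := by
    split_ifs <;> simp_all
  anti i j s t h1 h2 := by grind
  diag i j s t h1 h2 := by
    have : ¬ (s = j ∧ i = t) := by rintro ⟨rfl, rfl⟩; exact lt_asymm h1 h2
    split_ifs <;> simp_all

theorem rMat_apply_comm (i j l m : C) : rMat C a b i j l m = rMat C a b l m i j := by
  unfold rMat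
  split_ifs <;> simp only [Matrix.add_apply, Matrix.one_apply, Matrix.single_apply,
    Matrix.zero_apply] <;> grind

end QuadClosure

section QM

variable {k : Type*} [CommRing k] (a b : k) (R C : Type*) [LinearOrder R] [LinearOrder C]

/-- The relations of the algebra of rectangular quantum matrices. -/
inductive QMRel : FreeAlgebra k (R × C) → FreeAlgebra k (R × C) → Prop
  | row {i : R} {j l : C} (h : j < l) :
      QMRel (FreeAlgebra.ι k (i, j) * FreeAlgebra.ι k (i, l))
        (a • (FreeAlgebra.ι k (i, l) * FreeAlgebra.ι k (i, j)))
  | col {i s : R} {j : C} (h : i < s) :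
      QMRel (FreeAlgebra.ι k (i, j) * FreeAlgebra.ι k (s, j))
        (a • (FreeAlgebra.ι k (s, j) * FreeAlgebra.ι k (i, j)))
  | anti {i s : R} {j t : C} (h1 : s < i) (h2 : j < t) :
      QMRel (FreeAlgebra.ι k (i, j) * FreeAlgebra.ι k (s, t))
        (FreeAlgebra.ι k (s, t) * FreeAlgebra.ι k (i, j))
  | diag {i s : R} {j t : C} (h1 : i < s) (h2 : j < t) :
      QMRel (FreeAlgebra.ι k (i, j) * FreeAlgebra.ι k (s, t))
        (FreeAlgebra.ι k (s, t) * FreeAlgebra.ι k (i, j)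
          + (a - b) • (FreeAlgebra.ι k (i, t) * FreeAlgebra.ι k (s, j)))

/-- The algebra of rectangular quantum matrices. -/
abbrev QM : Type _ := RingQuot (QMRel a b R C)

/-- The generators of the algebra of rectangular quantum matrices. -/
def QM.gen (i : R) (j : C) : QM a b R C :=
  RingQuot.mkAlgHom k (QMRel a b R C) (FreeAlgebra.ι k (i, j))

theorem QM.gen_isQuad :
    IsQuad a b (fun i j s t => QM.gen a b R C i j * QM.gen a b R C s t) where
  row i j l h := by
    simpa [QM.gen] using RingQuot.mkAlgHom_rel k (QMRel.row (a := a) (b := b) (i := i) h)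
  col i s j h := by
    simpa [QM.gen] using RingQuot.mkAlgHom_rel k (QMRel.col (a := a) (b := b) (j := j) h)
  anti i j s t h1 h2 := by
    simpa [QM.gen] using RingQuot.mkAlgHom_rel k (QMRel.anti (a := a) (b := b) h1 h2)
  diag i j s t h1 h2 := by
    simpa [QM.gen] using RingQuot.mkAlgHom_rel k (QMRel.diag (a := a) (b := b) h1 h2)

variable {a b R C} {T : Type*} [Ring T] [Algebra k T]

theorem QM.exists_lift {X : R → C → T} (hX : IsQuad a b (fun i j s t => X i j * X s t)) :
    ∃ φ : QM a b R C →ₐ[k] T, ∀ i j, φ (QM.gen a b R C i j) = X i j := by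
  refine ⟨RingQuot.liftAlgHom k ⟨FreeAlgebra.lift k (fun p => X p.1 p.2), ?_⟩, ?_⟩
  · intro x y h
    induction h with
    | row h => simpa using hX.row _ _ _ h
    | col h => simpa using hX.col _ _ _ h
    | anti h1 h2 => simpa using hX.anti _ _ _ _ h1 h2
    | diag h1 h2 => simpa using hX.diag _ _ _ _ h1 h2
  · intro i j
    simp [QM.gen]

@[elab_as_elim]
theorem QM.induction {p : QM a b R C → Prop} (hone : ∀ r : k, p (algebraMap k _ r))
    (hgen : ∀ i j, p (QM.gen a b R C i j)) (hadd : ∀ x y, p x → p y → p (x + y))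
    (hmul : ∀ x y, p x → p y → p (x * y)) (x : QM a b R C) : p x := by
  obtain ⟨y, rfl⟩ := RingQuot.mkAlgHom_surjective k (QMRel a b R C) x
  induction y using FreeAlgebra.induction with
  | grade0 r => simpa using hone r
  | grade1 v => exact hgen v.1 v.2
  | mul x y hx hy => simpa using hmul _ _ hx hy
  | add x y hx hy => simpa using hadd _ _ hx hy

end QM

section LOperators

variable {k : Type*} [CommRing k] {a b : k} {R C : Type*} [LinearOrder R] [LinearOrder C]
  [Fintype C]

/-- Matrices with entries in an algebra, from a scalar matrix and an element of the algebra. -/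
def matSmul {k C T : Type*} [CommRing k] [Ring T] [Algebra k T] :
    T →ₗ[k] Matrix C C k →ₗ[k] Matrix C C T :=
  LinearMap.mk₂ k (fun x Z => Z.map (fun z => z • x))
    (fun x y Z => by ext; simp) (fun c x Z => by ext; exact smul_comm _ _ _)
    (fun x Z W => by ext; simp [add_smul]) (fun c x Z => by ext; simp [mul_smul])

theorem matSmul_apply {k C T : Type*} [CommRing k] [Ring T] [Algebra k T] (x : T)
    (Z : Matrix C C k) (i j : C) : matSmul (k := k) x Z i j = Z i j • x := rfl

theorem matSmul_mul {k C T : Type*} [CommRing k] [Ring T] [Algebra k T] [Fintype C] (x y : T)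
    (Z W : Matrix C C k) :
    matSmul (k := k) x Z * matSmul (k := k) y W = matSmul (k := k) (x * y) (Z * W) := by
  ext i j
  simp [Matrix.mul_apply, matSmul_apply, Finset.sum_smul, smul_smul, mul_comm]

/-- The `L`-operators, describing how the entries of a new row move past the previous rows. -/
theorem exists_lHom (hab : a * b = 1) :
    ∃ φ : QM a b R C →ₐ[k] Matrix C C (QM a b R C), ∀ i j,
      φ (QM.gen a b R C i j) = ∑ l, matSmul (QM.gen a b R C i l) (rMat C a b l j) := by
  apply QM.exists_lift
  simpa only [Finset.sum_mul_sum, matSmul_mul] using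
    (QM.gen_isQuad a b R C).comp hab (rMat_isQuad hab) (matSmul (k := k))

theorem exists_lOp (hab : a * b = 1) :
    ∃ L : C → C → QM a b R C →ₗ[k] QM a b R C,
      (∀ t u x y, L t u (x * y) = ∑ l, L t l x * L l u y) ∧
      (∀ t u, L t u 1 = if t = u then 1 else 0) ∧
      (∀ t u i j, L t u (QM.gen a b R C i j) =
        ∑ l, rMat C a b t u l j • QM.gen a b R C i l) ∧
      IsQuad a b (fun i j s t => L i j * L s t) := by
  obtain ⟨φ, hφ⟩ := exists_lHom (R := R) (C := C) hab
  let L : C → C → QM a b R C →ₗ[k] QM a b R C := fun t u =>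
    (Matrix.entryLinearMap k (QM a b R C) t u) ∘ₗ φ.toLinearMap
  have hmul : ∀ t u x y, L t u (x * y) = ∑ l, L t l x * L l u y := by
    intro t u x y
    simp [L, Matrix.mul_apply]
  have hone : ∀ t u, L t u 1 = if t = u then 1 else 0 := by
    intro t u
    simp [L, Matrix.one_apply]
  have hgen : ∀ t u i j, L t u (QM.gen a b R C i j) =
      ∑ l, rMat C a b t u l j • QM.gen a b R C i l := by
    intro t u i j
    simp [L, hφ, matSmul_apply, rMat_apply_comm t u]
  have key : ∀ x, IsQuad a b (fun i j s t => L i j (L s t x)) := by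
    intro x
    induction x using QM.induction with
    | hone r =>
      convert isQuad_delta (C := C) (a := a) (b := b) (algebraMap k (QM a b R C) r) using 5
      simp only [Algebra.algebraMap_eq_smul_one, map_smul, hone]
      split_ifs <;> simp [*]
    | hgen u v =>
      let f : Matrix C C k →ₗ[k] QM a b R C :=
        ∑ m, (LinearMap.toSpanSingleton k _ (QM.gen a b R C u m)) ∘ₗ
          (Matrix.entryLinearMap k k m v)
      convert (rMat_isQuad hab).map f using 5 with i j s t
      simp only [hgen, map_sum, map_smul]
      simp only [f, LinearMap.sum_apply, LinearMap.comp_apply, Matrix.entryLinearMap_apply,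
        LinearMap.toSpanSingleton_apply, Matrix.mul_apply, Finset.sum_smul, Finset.smul_sum,
        smul_smul]
      rw [Finset.sum_comm]
      simp only [mul_comm]
    | hadd x y hx hy =>
      simpa only [map_add] using hx.add hy
    | hmul x y hx hy =>
      convert hx.comp hab hy (LinearMap.mul k _) using 5 with i j s t
      simp only [hmul, map_sum, LinearMap.mul_apply']
      rw [Finset.sum_comm]
  refine ⟨L, hmul, hone, hgen, ?_⟩
  constructor
  · intro i j l h; ext x; exact (key x).row i j l h
  · intro i s j h; ext x; exact (key x).col i s j h
  · intro i j s t h1 h2; ext x; exact (key x).anti i j s t h1 h2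
  · intro i j s t h1 h2; ext x; exact (key x).diag i j s t h1 h2

end LOperators

section NewRow

variable {k : Type*} [CommRing k] {a b : k} {C : Type*} [LinearOrder C] [Fintype C]

/-- Left multiplication by a generator of the quantum affine space, on its monomial basis. -/
noncomputable def affineMul (b : k) (j : C) : ((C → ℕ) →₀ k) →ₗ[k] ((C → ℕ) →₀ k) :=
  Finsupp.linearCombination k
    (fun e : C → ℕ => Finsupp.single (e + Pi.single j 1) (b ^ ∑ l with l < j, e l))

theorem affineMul_single (j : C) (e : C → ℕ) :
    affineMul b j (Finsupp.single e 1) =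
      Finsupp.single (e + Pi.single j 1) (b ^ ∑ l with l < j, e l) := by
  simp [affineMul]

theorem affineMul_isQuad (hab : a * b = 1) :
    IsQuad a b (fun (i : C) (_ : Fin 1) (s : C) (_ : Fin 1) =>
      affineMul b i * affineMul b s) where
  row i j l h := absurd h (by simp [Subsingleton.elim j l])
  col i s j h := by
    ext1 e
    ext1
    have h1 : ∑ l with l < i, (Pi.single s 1 : C → ℕ) l = 0 :=
      Finset.sum_eq_zero fun l hl => by
        simp only [Finset.mem_filter] at hl
        simp [(hl.2.trans h).ne]
    have h2 : ∑ l with l < s, (Pi.single i 1 : C → ℕ) l = 1 := by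
      rw [Finset.sum_eq_single i] <;> simp +contextual [h]
    have key : ∀ (u v : C), affineMul b u (affineMul b v (Finsupp.single e 1)) =
        (b ^ (∑ l with l < v, e l) * b ^ ((∑ l with l < u, e l) +
          ∑ l with l < u, (Pi.single v 1 : C → ℕ) l)) •
          Finsupp.single (e + Pi.single v 1 + Pi.single u 1) 1 := by
      intro u v
      rw [affineMul_single, ← mul_one (b ^ _), ← Finsupp.smul_single', map_smul,
        affineMul_single, mul_one, mul_smul, Finsupp.smul_single' _ _ (1 : k), mul_one]
      simp only [Pi.add_apply, Finset.sum_add_distrib]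
    simp only [LinearMap.comp_apply, Finsupp.lsingle_apply, LinearMap.smul_apply,
      Module.End.mul_apply, key, h1, h2]
    rw [add_right_comm e, smul_smul]
    congr 1
    rw [pow_succ]
    linear_combination (-hab) * (b ^ (∑ l with l < s, e l) * b ^ (∑ l with l < i, e l))
  anti i j s t h1 h2 := absurd h2 (by simp [Subsingleton.elim j t])
  diag i j s t h1 h2 := absurd h2 (by simp [Subsingleton.elim j t])

/-- Extending a representation of quantum matrices by a new row. -/
theorem exists_lift_newRow {T : Type*} [Ring T] [Algebra k T] (hab : a * b = 1) {m : ℕ}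
    {G : Fin m → C → T} {Y : C → T} (hG : IsQuad a b (fun i j s t => G i j * G s t))
    (hY : ∀ j l, j < l → Y j * Y l = a • (Y l * Y j))
    (hYG : ∀ t i j, Y t * G i j = ∑ u, ∑ l, rMat C a b t u l j • (G i l * Y u)) :
    ∃ φ : QM a b (Fin (m + 1)) C →ₐ[k] T,
      (∀ i j, φ (QM.gen a b _ C (Fin.castSucc i) j) = G i j) ∧
      (∀ j, φ (QM.gen a b _ C (Fin.last m) j) = Y j) := by
  have hgt : ∀ t i j, t < j → Y t * G i j = G i j * Y t := by
    intro t i j h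
    rw [hYG, Finset.sum_eq_single t, Finset.sum_eq_single j]
    · simp [rMat_self, h.ne]
    · intro l _ hl
      simp [rMat_self, h.ne, Matrix.one_apply_ne hl]
    · simp
    · intro u _ hu
      refine Finset.sum_eq_zero fun l _ => ?_
      rcases hu.lt_or_gt with h' | h'
      · simp [rMat_of_lt h', (h'.trans h).ne]
      · simp [rMat_of_gt h']
    · simp
  have heq : ∀ i j, Y j * G i j = b • (G i j * Y j) := by
    intro i j
    rw [hYG, Finset.sum_eq_single j, Finset.sum_eq_single j]
    · simp [rMat_self]
    · intro l _ hl
      simp [rMat_self, hl.symm, Matrix.one_apply_ne hl]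
    · simp
    · intro u _ hu
      refine Finset.sum_eq_zero fun l _ => ?_
      rcases hu.lt_or_gt with h' | h'
      · simp [rMat_of_lt h', h'.ne]
      · simp [rMat_of_gt h']
    · simp
  have hlt : ∀ t i j, j < t →
      Y t * G i j = G i j * Y t + (b - a) • (G i t * Y j) := by
    intro t i j h
    have hz : ∀ u, u ≠ t ∧ u ≠ j → ∑ l, rMat C a b t u l j • (G i l * Y u) = 0 := by
      rintro u ⟨hu, hu'⟩
      refine Finset.sum_eq_zero fun l _ => ?_
      rcases hu.lt_or_gt with h' | h'
      · simp [rMat_of_lt h', hu']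
      · simp [rMat_of_gt h']
    rw [hYG, Fintype.sum_eq_add t j h.ne' hz, Finset.sum_eq_single j, Finset.sum_eq_single t]
    · simp [rMat_self, rMat_of_lt h, h.ne']
    · intro l _ hl
      simp [rMat_of_lt h, hl.symm]
    · simp
    · intro l _ hl
      simp [rMat_self, h.ne', Matrix.one_apply_ne hl]
    · simp
  let X : Fin (m + 1) → C → T := Fin.lastCases Y (fun i j => G i j)
  have hXl : ∀ j, X (Fin.last m) j = Y j := fun j => by simp [X]
  have hXc : ∀ i j, X (Fin.castSucc i) j = G i j := fun i j => by simp [X]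
  have hX : IsQuad a b (fun i j s t => X i j * X s t) := by
    refine ⟨fun i j l h => ?_, fun i s j h => ?_, fun i j s t h1 h2 => ?_,
      fun i j s t h1 h2 => ?_⟩
    · induction i using Fin.lastCases with
      | last =>
        simp only [hXl]
        exact hY j l h
      | cast i =>
        simp only [hXc]
        exact hG.row i j l h
    · induction i using Fin.lastCases with
      | last => exact absurd h (Fin.le_last s).not_gt
      | cast i =>
        induction s using Fin.lastCases with
        | last =>
          simp only [hXl, hXc, heq, smul_smul, hab, one_smul]
        | cast s =>
          simp only [hXc]
          exact hG.col i s j (by simpa using h)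
    · induction s using Fin.lastCases with
      | last => exact absurd h1 (Fin.le_last i).not_gt
      | cast s =>
        induction i using Fin.lastCases with
        | last =>
          simp only [hXl, hXc, hgt _ _ _ h2]
        | cast i =>
          simp only [hXc]
          exact hG.anti i j s t (by simpa using h1) h2
    · induction i using Fin.lastCases with
      | last => exact absurd h1 (Fin.le_last s).not_gt
      | cast i =>
        induction s using Fin.lastCases with
        | last =>
          simp only [hXl, hXc, hlt _ _ _ h2]
          module
        | cast s =>
          simp only [hXc]
          exact hG.diag i j s t (by simpa using h1) h2
  obtain ⟨φ, hφ⟩ := QM.exists_lift hX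
  exact ⟨φ, fun i j => by rw [hφ, hXc], fun j => by rw [hφ, hXl]⟩

open scoped TensorProduct

/-- Extending a tensor factor of a representation of quantum matrices by a new row acting on a
quantum affine space. -/
theorem exists_rowRep_of_lOp {S : Type*} [Ring S] [Algebra k S] (hab : a * b = 1) {m : ℕ}
    {g : Fin m → C → S} (hg : IsQuad a b (fun i j s t => g i j * g s t))
    {L : C → C → S →ₗ[k] S} (hmul : ∀ t u x y, L t u (x * y) = ∑ l, L t l x * L l u y)
    (hone : ∀ t u, L t u 1 = if t = u then 1 else 0)
    (hgen : ∀ t u i j, L t u (g i j) = ∑ l, rMat C a b t u l j • g i l)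
    (hL : IsQuad a b (fun i j s t => L i j * L s t)) :
    ∃ φ : QM a b (Fin (m + 1)) C →ₐ[k] Module.End k (S ⊗[k] ((C → ℕ) →₀ k)),
      (∀ i j x v, φ (QM.gen a b _ C (Fin.castSucc i) j) (x ⊗ₜ v) = (g i j * x) ⊗ₜ v) ∧
      (∀ j v, φ (QM.gen a b _ C (Fin.last m) j) (1 ⊗ₜ v) = 1 ⊗ₜ affineMul b j v) := by
  let G : S →ₐ[k] Module.End k (S ⊗[k] ((C → ℕ) →₀ k)) :=
    (Module.End.rTensorAlgHom k _ _).comp (Algebra.lmul k _)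
  have hGa : ∀ y x v, G y (x ⊗ₜ v) = (y * x) ⊗ₜ v := fun y x v => rfl
  have hY := IsQuad.comp (Z := Module.End k (S ⊗[k] ((C → ℕ) →₀ k))) hab hL
    (affineMul_isQuad hab) (TensorProduct.mapBilinear (RingHom.id k) S ((C → ℕ) →₀ k) S
      ((C → ℕ) →₀ k))
  have hGG : IsQuad a b (fun i j s t => G (g i j) * G (g s t)) :=
    IsQuad.map_algHom (T := Module.End k (S ⊗[k] ((C → ℕ) →₀ k))) hg G
  let Y : C → Module.End k (S ⊗[k] ((C → ℕ) →₀ k)) := fun j =>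
    ∑ l, TensorProduct.map (L j l) (affineMul b l)
  have hYY : ∀ j l, j < l → Y j * Y l = a • (Y l * Y j) := by
    intro j l h
    convert hY.col j l 0 h using 2
    · ext
      simp [Y, Finset.sum_mul_sum]
    · ext
      simp [Y, Finset.sum_mul_sum]
  have hYG : ∀ t i j, Y t * G (g i j) = ∑ u, ∑ l, rMat C a b t u l j • (G (g i l) * Y u) := by
    intro t i j
    ext x e : 4
    simp only [Y, TensorProduct.AlgebraTensorModule.curry_apply, LinearMap.restrictScalars_self,
      TensorProduct.curry_apply, LinearMap.coe_comp, Function.comp_apply, Finsupp.lsingle_apply,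
      Module.End.mul_apply, LinearMap.sum_apply, LinearMap.smul_apply, hGa, TensorProduct.map_tmul,
      hmul, hgen, Finset.sum_mul, TensorProduct.sum_tmul, Finset.smul_sum, map_sum]
    rw [Finset.sum_comm]
    refine Finset.sum_congr rfl fun u _ => ?_
    rw [Finset.sum_comm]
    simp only [TensorProduct.smul_tmul', smul_mul_assoc]
  obtain ⟨φ, h1, h2⟩ := exists_lift_newRow (T := Module.End k (S ⊗[k] ((C → ℕ) →₀ k)))
    (G := fun i j => G (g i j)) (Y := Y) hab hGG hYY hYG
  refine ⟨φ, ?_, ?_⟩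
  · intro i j x v
    rw [h1, hGa]
  · intro j v
    simp [h2, Y, hone, TensorProduct.ite_tmul]

/-- Quantum matrices with one more row act on the quantum matrices tensored with a quantum affine
space. -/
theorem exists_rowRep (hab : a * b = 1) (m : ℕ) :
    ∃ φ : QM a b (Fin (m + 1)) C →ₐ[k]
        Module.End k (QM a b (Fin m) C ⊗[k] ((C → ℕ) →₀ k)),
      (∀ i j x v, φ (QM.gen a b _ C (Fin.castSucc i) j) (x ⊗ₜ v) =
        (QM.gen a b _ C i j * x) ⊗ₜ v) ∧
      (∀ j v, φ (QM.gen a b _ C (Fin.last m) j) (1 ⊗ₜ v) = 1 ⊗ₜ affineMul b j v) := by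
  obtain ⟨L, hmul, hone, hgen, hL⟩ := exists_lOp (R := Fin m) (C := C) hab
  exact exists_rowRep_of_lOp hab (QM.gen_isQuad a b (Fin m) C) hmul hone hgen hL

end NewRow

section PBW

/-- The ordered monomial with exponents `A` in a family of elements indexed by a rectangle. -/
def rectMon {T : Type*} [Monoid T] {m n : ℕ} (X : Fin m → Fin n → T) (A : Fin m → Fin n → ℕ) : T :=
  ((List.finRange m).map fun i => ((List.finRange n).map fun j => X i j ^ A i j).prod).prod

theorem rectMon_succ {T : Type*} [Monoid T] {m n : ℕ} (X : Fin (m + 1) → Fin n → T)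
    (A : Fin (m + 1) → Fin n → ℕ) :
    rectMon X A = rectMon (fun i => X i.castSucc) (fun i => A i.castSucc) *
      ((List.finRange n).map fun j => X (Fin.last m) j ^ A (Fin.last m) j).prod := by
  simp [rectMon, List.finRange_succ_last, Function.comp_def]

theorem map_rectMon {S T F : Type*} [Monoid S] [Monoid T] [FunLike F S T] [MonoidHomClass F S T]
    {m n : ℕ} (f : F) (X : Fin m → Fin n → S) (A : Fin m → Fin n → ℕ) :
    f (rectMon X A) = rectMon (fun i j => f (X i j)) A := by
  simp [rectMon, map_list_prod, Function.comp_def]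

variable {k : Type*} [CommRing k] {a b : k} {C : Type*} [LinearOrder C] [Fintype C]

theorem pow_apply_tmul_single {S : Type*} [Ring S] [Algebra k S] {j : C}
    {Y : Module.End k (S ⊗[k] ((C → ℕ) →₀ k))}
    (hY : ∀ v, Y (1 ⊗ₜ v) = 1 ⊗ₜ affineMul b j v) {e : C → ℕ} (he : ∀ l < j, e l = 0) (p : ℕ) :
    (Y ^ p) (1 ⊗ₜ Finsupp.single e 1) = 1 ⊗ₜ Finsupp.single (e + Pi.single j p) 1 := by
  induction p with
  | zero => simp
  | succ p ih =>
    have hz : ∑ l with l < j, (e + Pi.single j p : C → ℕ) l = 0 :=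
      Finset.sum_eq_zero fun l hl => by
        simp only [Finset.mem_filter] at hl
        simp [hl.2.ne, he l hl.2]
    rw [pow_succ', Module.End.mul_apply, ih, hY, affineMul_single, hz, pow_zero, add_assoc,
      ← Pi.single_add]

theorem prod_pow_apply_tmul_single {S : Type*} [Ring S] [Algebra k S]
    {Y : C → Module.End k (S ⊗[k] ((C → ℕ) →₀ k))}
    (hY : ∀ j v, Y j (1 ⊗ₜ v) = 1 ⊗ₜ affineMul b j v) (e : C → ℕ) {l : List C}
    (hl : l.Pairwise (· < ·)) :
    (l.map fun j => Y j ^ e j).prod (1 ⊗ₜ Finsupp.single 0 1) =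
      1 ⊗ₜ Finsupp.single (fun j => if j ∈ l then e j else 0) 1 := by
  induction l with
  | nil => simp [Pi.zero_def]
  | cons j l ih =>
    rw [List.pairwise_cons] at hl
    rw [List.map_cons, List.prod_cons, Module.End.mul_apply, ih hl.2,
      pow_apply_tmul_single (hY j)]
    · congr 2
      ext t
      by_cases h : t = j
      · subst h
        have : t ∉ l := fun h => (hl.1 t h).false
        simp [this]
      · simp [h]
    · intro t ht
      have : t ∉ l := fun h => (hl.1 t h).not_gt ht
      simp [this]

theorem rectMon_apply_tmul {S V : Type*} [Ring S] [Algebra k S] [AddCommGroup V] [Module k V]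
    {m n : ℕ} {X : Fin m → Fin n → Module.End k (S ⊗[k] V)} {g : Fin m → Fin n → S}
    (h : ∀ i j x v, X i j (x ⊗ₜ v) = (g i j * x) ⊗ₜ v) (A : Fin m → Fin n → ℕ) (x : S) (v : V) :
    rectMon X A (x ⊗ₜ v) = (rectMon g A * x) ⊗ₜ v := by
  let G : S →ₐ[k] Module.End k (S ⊗[k] V) := (Module.End.rTensorAlgHom k _ _).comp (Algebra.lmul k _)
  have hX : X = fun i j => G (g i j) := by
    funext i j
    exact TensorProduct.ext' (h i j)
  rw [hX, ← map_rectMon]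
  rfl

end PBW

section PBWDomain

variable {k : Type*} [CommRing k] [IsDomain k] {a b : k}

theorem linearIndependent_succ_tmul {S V : Type*} [AddCommGroup S] [Module k S] [AddCommGroup V]
    [Module k V] {m : ℕ} {α : Type*} {x : (Fin m → α) → S} {v : α → V}
    (hx : LinearIndependent k x) (hv : LinearIndependent k v) :
    LinearIndependent k
      (fun A : Fin (m + 1) → α => x (fun i => A i.castSucc) ⊗ₜ[k] v (A (Fin.last m))) := by
  have hinj : Function.Injective (fun A : Fin (m + 1) → α =>
      (((fun i => A i.castSucc), A (Fin.last m)) : (Fin m → α) × α)) := by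
    intro A B h
    simp only [Prod.mk.injEq] at h
    ext i
    induction i using Fin.lastCases with
    | last => rw [h.2]
    | cast i => exact congrFun h.1 i
  exact (hx.tmul_of_isDomain hv).comp
    (fun A : Fin (m + 1) → α => ((fun i => A i.castSucc, A (Fin.last m)) : (Fin m → α) × α)) hinj

theorem linearIndependent_rectMon_succ {S T : Type*} [Ring S] [Algebra k S] [Ring T] [Algebra k T]
    {m n : ℕ} {g : Fin m → Fin n → S} (hg : LinearIndependent k (rectMon g))
    {x : Fin (m + 1) → Fin n → T} {φ : T →ₐ[k] Module.End k (S ⊗[k] ((Fin n → ℕ) →₀ k))}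
    (h1 : ∀ i j s v, φ (x (Fin.castSucc i) j) (s ⊗ₜ v) = (g i j * s) ⊗ₜ v)
    (h2 : ∀ j v, φ (x (Fin.last m) j) (1 ⊗ₜ v) = 1 ⊗ₜ affineMul b j v) :
    LinearIndependent k (rectMon x) := by
  let f : T →ₗ[k] S ⊗[k] ((Fin n → ℕ) →₀ k) :=
    (LinearMap.applyₗ (1 ⊗ₜ Finsupp.single 0 1)) ∘ₗ φ.toLinearMap
  apply LinearIndependent.of_comp f
  have hs : LinearIndependent k (fun e : Fin n → ℕ => Finsupp.single e (1 : k)) :=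
    Finsupp.linearIndependent_single_one k _
  have hf : f ∘ rectMon x = fun A =>
      rectMon g (fun i => A i.castSucc) ⊗ₜ[k] Finsupp.single (A (Fin.last m)) (1 : k) := by
    ext1 A
    simp only [f, Function.comp_apply, LinearMap.comp_apply, AlgHom.toLinearMap_apply,
      LinearMap.applyₗ_apply_apply]
    rw [map_rectMon, rectMon_succ, Module.End.mul_apply,
      prod_pow_apply_tmul_single h2 _ (List.pairwise_lt_finRange n), rectMon_apply_tmul h1]
    simp
  rw [hf]
  exact linearIndependent_succ_tmul (x := rectMon g)
    (v := fun e : Fin n → ℕ => Finsupp.single e (1 : k)) hg hs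

/-- Ordered monomials in quantum matrices are linearly independent. -/
theorem linearIndependent_rectMon (hab : a * b = 1) (m n : ℕ) :
    LinearIndependent k (rectMon (QM.gen a b (Fin m) (Fin n))) := by
  induction m with
  | zero =>
    obtain ⟨φ, -⟩ := QM.exists_lift (T := k) (a := a) (b := b) (R := Fin 0) (C := Fin n)
      (X := fun _ _ => 0) ⟨by simp, by simp, by simp, by simp⟩
    apply LinearIndependent.of_comp φ.toLinearMap
    rw [linearIndependent_unique_iff]
    simp [rectMon]
  | succ m ih =>
    obtain ⟨φ, h1, h2⟩ := exists_rowRep (C := Fin n) hab m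
    exact linearIndependent_rectMon_succ ih h1 h2

end PBWDomain

section Oq

theorem qq_ne_zero : (qq : Kq) ≠ 0 := RatFunc.X_ne_zero

theorem linearIndependent_xMod (n : ℕ) : LinearIndependent Kq (xMod n) := by
  have hab : qq ^ 2 * qq⁻¹ ^ 2 = 1 := by
    rw [← mul_pow, mul_inv_cancel₀ qq_ne_zero, one_pow]
  have hq := QM.gen_isQuad (qq ^ 2) (qq⁻¹ ^ 2) (Fin n) (Fin n)
  let φ : Oq n →ₐ[Kq] QM (qq ^ 2) (qq⁻¹ ^ 2) (Fin n) (Fin n) :=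
    RingQuot.liftAlgHom Kq ⟨FreeAlgebra.lift Kq (fun p => QM.gen _ _ _ _ p.1 p.2), by
      intro x y h
      induction h with
      | rel_row h => simpa using hq.row _ _ _ h
      | rel_col h => simpa using hq.col _ _ _ h
      | rel_anti h1 h2 => simpa using hq.anti _ _ _ _ h1 h2
      | rel_diag h1 h2 => simpa using hq.diag _ _ _ _ h1 h2⟩
  have hφ : ∀ i j, φ (xgen n i j) = QM.gen _ _ _ _ i j := fun i j => by simp [φ, xgen]
  have hmon : LinearIndependent Kq (xMon n) := by
    apply LinearIndependent.of_comp φ.toLinearMap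
    have : φ.toLinearMap ∘ xMon n =
        fun A : Mat n => rectMon (QM.gen (qq ^ 2) (qq⁻¹ ^ 2) (Fin n) (Fin n)) (fun i j => A i j) := by
      funext A
      change φ (rectMon (xgen n) (fun i j => A i j)) = _
      rw [map_rectMon]
      simp only [hφ]
    rw [this]
    exact linearIndependent_rectMon hab n n
  exact hmon.units_smul fun A => Units.mk0 _ (zpow_ne_zero (-(eExp n A : ℤ)) qq_ne_zero)

end Oq

section MatOrder

variable {n : ℕ}

/-- The elementary matrix with natural number entries. -/
abbrev elem (p : Fin n × Fin n) : Mat n := Matrix.single p.1 p.2 1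

theorem matStep.add_elem_eq {M M' : Mat n} (h : matStep n M M') :
    ∃ i s j t : Fin n, i < s ∧ j < t ∧
      M + elem (i, t) + elem (s, j) = M' + elem (i, j) + elem (s, t) := by
  obtain ⟨i, s, j, t, his, hjt, h1, h2, h3, h4, h5, h6, h7⟩ := h
  refine ⟨i, s, j, t, his, hjt, ?_⟩
  ext u v
  have := h7 u v
  have := his.ne
  have := hjt.ne
  simp only [Matrix.add_apply, Matrix.single_apply]
  grind

theorem matStep_elem {i s j t : Fin n} (his : i < s) (hjt : j < t) :
    matStep n (elem (i, j) + elem (s, t)) (elem (i, t) + elem (s, j)) := by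
  have := his.ne
  have := hjt.ne
  refine ⟨i, s, j, t, his, hjt, ?_⟩
  simp only [Matrix.add_apply, Matrix.single_apply]
  grind

theorem matStep.add_left {M M' : Mat n} (N : Mat n) (h : matStep n M M') :
    matStep n (N + M) (N + M') := by
  obtain ⟨i, s, j, t, his, hjt, h1, h2, h3, h4, h5, h6, h7⟩ := h
  refine ⟨i, s, j, t, his, hjt, ?_, ?_, ?_, ?_, ?_, ?_, fun u v huv => ?_⟩
  any_goals simp only [Matrix.add_apply]
  any_goals omega
  rw [h7 u v huv]

theorem matLT.add_left {M M' : Mat n} (N : Mat n) (h : matLT n M M') :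
    matLT n (N + M) (N + M') :=
  Relation.TransGen.lift (N + ·) (fun _ _ => matStep.add_left N) _ _ h

/-- Pairing of a matrix with a weight on the positions. -/
def matWeight (w : Fin n → Fin n → ℕ) : Mat n →+ ℕ where
  toFun M := ∑ i, ∑ j, M i j * w i j
  map_zero' := by simp
  map_add' M N := by simp [add_mul, Finset.sum_add_distrib]

theorem matWeight_elem (w : Fin n → Fin n → ℕ) (p : Fin n × Fin n) :
    matWeight w (elem p) = w p.1 p.2 := by
  simp only [matWeight, AddMonoidHom.coe_mk, ZeroHom.coe_mk, Matrix.single_apply]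
  rw [Finset.sum_eq_single p.1, Finset.sum_eq_single p.2] <;> simp +contextual [eq_comm]

theorem matLT.weight_lt {M M' : Mat n} (h : matLT n M M') :
    matWeight (fun i j => i.val * j.val) M < matWeight (fun i j => i.val * j.val) M' := by
  induction h with
  | single h =>
    obtain ⟨i, s, j, t, his, hjt, h⟩ := h.add_elem_eq
    apply_fun matWeight (fun i j => i.val * j.val) at h
    simp only [map_add, matWeight_elem] at h
    have : i.val < s.val := his
    have : j.val < t.val := hjt
    nlinarith
  | tail _ h ih =>
    obtain ⟨i, s, j, t, his, hjt, h⟩ := h.add_elem_eq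
    apply_fun matWeight (fun i j => i.val * j.val) at h
    simp only [map_add, matWeight_elem] at h
    have : i.val < s.val := his
    have : j.val < t.val := hjt
    nlinarith

theorem matLT.total_eq {M M' : Mat n} (h : matLT n M M') :
    matWeight (fun _ _ => 1) M = matWeight (fun _ _ => 1) M' := by
  induction h with
  | single h =>
    obtain ⟨i, s, j, t, his, hjt, h⟩ := h.add_elem_eq
    apply_fun matWeight (fun _ _ => 1) at h
    simp only [map_add, matWeight_elem] at h
    omega
  | tail _ h ih =>
    obtain ⟨i, s, j, t, his, hjt, h⟩ := h.add_elem_eq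
    apply_fun matWeight (fun _ _ => 1) at h
    simp only [map_add, matWeight_elem] at h
    omega

theorem wellFounded_matLT (n : ℕ) : WellFounded (matLT n) :=
  Subrelation.wf matLT.weight_lt
    (measure (fun M : Mat n => matWeight (fun i j => i.val * j.val) M)).wf

theorem matLT.trans {A B M : Mat n} (h1 : matLT n A B) (h2 : matLT n B M) : matLT n A M :=
  Relation.TransGen.trans h2 h1

theorem finite_matLT (A : Mat n) : {B | matLT n B A}.Finite := by
  refine (Set.finite_Icc (0 : Fin n → Fin n → ℕ)
    (fun _ _ => matWeight (fun _ _ => 1) A)).subset fun B hB => ⟨fun i j => Nat.zero_le _,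
      fun i j => ?_⟩
  have h : matLT n B A := hB
  rw [← h.total_eq]
  simp only [matWeight, AddMonoidHom.coe_mk, ZeroHom.coe_mk, mul_one]
  exact (Finset.single_le_sum (f := fun j => B i j) (fun _ _ => Nat.zero_le _)
    (Finset.mem_univ j)).trans (Finset.single_le_sum (f := fun i => ∑ j, B i j)
    (fun _ _ => Nat.zero_le _) (Finset.mem_univ i))

end MatOrder

section Words

variable {n : ℕ}

/-- The number of occurrences of each position in a word. -/
def content (w : List (Fin n × Fin n)) : Mat n := Matrix.of fun i j => w.count (i, j)

theorem content_cons (p : Fin n × Fin n) (w : List (Fin n × Fin n)) :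
    content (p :: w) = elem p + content w := by
  ext i j
  simp [content, List.count_cons, Matrix.single_apply, Prod.ext_iff, add_comm]

theorem content_eq_iff {w w' : List (Fin n × Fin n)} : content w = content w' ↔ w.Perm w' := by
  rw [List.perm_iff_count, Prod.forall]
  exact ⟨fun h i j => congrFun (congrFun h i) j, fun h => by ext i j; exact h i j⟩

/-- The exponent `c` such that `x_p x_r` equals `q ^ c x_r x_p` up to lower terms. -/
def comExp (p r : Fin n × Fin n) : ℤ :=
  2 * ((if p.1 = r.1 then (((r.2 : ℕ) : ℤ) - (p.2 : ℕ)).sign else 0) +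
    (if p.2 = r.2 then (((r.1 : ℕ) : ℤ) - (p.1 : ℕ)).sign else 0))

/-- The absolute value of `comExp`. -/
def comExpAbs (p r : Fin n × Fin n) : ℕ :=
  2 * ((if p.1 = r.1 ∧ p.2 ≠ r.2 then 1 else 0) + (if p.2 = r.2 ∧ p.1 ≠ r.1 then 1 else 0))

theorem comExpAbs_comm (p r : Fin n × Fin n) : comExpAbs p r = comExpAbs r p := by
  simp only [comExpAbs, eq_comm, ne_comm]

theorem comExpAbs_self (p : Fin n × Fin n) : comExpAbs p p = 0 := by
  simp [comExpAbs]

theorem comExp_eq_comExpAbs {p r : Fin n × Fin n} (h : p.1 < r.1 ∨ p.1 = r.1 ∧ p.2 ≤ r.2) :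
    comExp p r = comExpAbs p r := by
  obtain ⟨i, j⟩ := p
  obtain ⟨s, t⟩ := r
  simp only [comExp, comExpAbs] at h ⊢
  rcases h with h | ⟨rfl, h⟩
  · have : (((s : ℕ) : ℤ) - (i : ℕ)).sign = 1 := Int.sign_eq_one_of_pos (by
      have : i.val < s.val := h
      omega)
    simp [h.ne, this]
  · rcases h.eq_or_lt with rfl | h
    · simp
    · have : (((t : ℕ) : ℤ) - (j : ℕ)).sign = 1 := Int.sign_eq_one_of_pos (by
        have : j.val < t.val := h
        omega)
      simp [h.ne, this]

/-- The total exponent picked up when reversing a word. -/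
def revExp : List (Fin n × Fin n) → ℤ
  | [] => 0
  | p :: w => (w.map (comExp p)).sum + revExp w

theorem two_mul_revExp {w : List (Fin n × Fin n)}
    (hw : w.Pairwise fun p r => comExp p r = comExpAbs p r) :
    2 * revExp w = ((w.map fun p => (w.map (comExpAbs p)).sum).sum : ℕ) := by
  induction w with
  | nil => simp [revExp]
  | cons p w ih =>
    rw [List.pairwise_cons] at hw
    have h1 : w.map (comExp p) = w.map fun r => (comExpAbs p r : ℤ) :=
      List.map_congr_left hw.1
    have h2 : (w.map fun r => comExpAbs r p) = w.map (comExpAbs p) :=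
      List.map_congr_left fun r _ => comExpAbs_comm r p
    rw [revExp, mul_add, ih hw.2, h1]
    simp only [List.map_cons, List.sum_cons, comExpAbs_self, List.sum_map_add, h2]
    push_cast [List.map_map, Function.comp_def]
    ring

/-- The lexicographically sorted word of given content. -/
def sortedWord (A : Mat n) : List (Fin n × Fin n) :=
  (List.finRange n).flatMap fun i => (List.finRange n).flatMap fun j => List.replicate (A i j) (i, j)

theorem sum_map_finRange {n : ℕ} {M : Type*} [AddCommMonoid M] (f : Fin n → M) :
    ((List.finRange n).map f).sum = ∑ i, f i := by
  rw [← List.ofFn_eq_map, List.sum_ofFn]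

theorem content_sortedWord (A : Mat n) : content (sortedWord A) = A := by
  ext i j
  simp only [content, sortedWord, Matrix.of_apply, List.count_flatMap, Function.comp_def,
    sum_map_finRange, List.count_replicate, beq_iff_eq, Prod.mk.injEq]
  rw [Finset.sum_eq_single i, Finset.sum_eq_single j] <;> simp +contextual

theorem pairwise_sortedWord (A : Mat n) :
    (sortedWord A).Pairwise fun p r => comExp p r = comExpAbs p r := by
  have : (sortedWord A).Pairwise fun p r => p.1 < r.1 ∨ p.1 = r.1 ∧ p.2 ≤ r.2 := by
    simp only [sortedWord, List.pairwise_flatMap]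
    refine ⟨fun i _ => ⟨fun j _ => List.pairwise_replicate.2 (by simp),
      (List.pairwise_lt_finRange n).imp fun h => ?_⟩,
      (List.pairwise_lt_finRange n).imp fun h => ?_⟩
    · intro x hx y hy
      rw [List.mem_replicate] at hx hy
      simp [hx.2, hy.2, h.le]
    · intro x hx y hy
      simp only [List.mem_flatMap, List.mem_replicate] at hx hy
      obtain ⟨_, _, _, rfl⟩ := hx
      obtain ⟨_, _, _, rfl⟩ := hy
      exact Or.inl h
  exact this.imp comExp_eq_comExpAbs

theorem sum_map_word (w : List (Fin n × Fin n)) (f : Fin n × Fin n → ℕ) :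
    (w.map f).sum = ∑ i, ∑ j, content w i j * f (i, j) := by
  rw [← Fintype.sum_prod_type' (f := fun i j => content w i j * f (i, j)),
    Finset.sum_list_map_count]
  refine Finset.sum_subset_zero_on_sdiff (Finset.subset_univ _) ?_ ?_
  · intro p hp
    simp only [Finset.mem_sdiff, Finset.mem_univ, List.mem_toFinset, true_and] at hp
    simp [content, List.count_eq_zero_of_not_mem hp]
  · intro p _
    simp only [content, Matrix.of_apply, smul_eq_mul]
    congr!

theorem sum_sum_ne (f : Fin n → ℕ) :
    ∑ j, f j * ∑ t, (if j ≠ t then f t else 0) = 2 * ∑ j, ∑ k with k < j, f j * f k := by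
  have h0 : ∀ j, f j * ∑ t, (if j ≠ t then f t else 0) =
      ∑ t, (if j ≠ t then f j * f t else 0) := by
    simp [Finset.mul_sum]
  simp only [h0]
  have h : ∑ j, ∑ t, (if j < t then f j * f t else 0) =
      ∑ j, ∑ k with k < j, f j * f k := by
    rw [Finset.sum_comm]
    simp only [Finset.sum_filter, mul_comm]
  have h' : ∑ j, ∑ t, (if t < j then f j * f t else 0) =
      ∑ j, ∑ k with k < j, f j * f k := by
    simp only [Finset.sum_filter]
  rw [two_mul]
  nth_rw 1 [← h]
  rw [← h', ← Finset.sum_add_distrib]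
  refine Finset.sum_congr rfl fun j _ => ?_
  rw [← Finset.sum_add_distrib]
  refine Finset.sum_congr rfl fun t _ => ?_
  rcases lt_trichotomy j t with h | rfl | h
  · simp [h, h.ne, h.not_gt]
  · simp
  · simp [h, h.ne', h.not_gt]

theorem revExp_sortedWord (A : Mat n) : revExp (sortedWord A) = 2 * eExp n A := by
  have h := two_mul_revExp (pairwise_sortedWord A)
  simp only [sum_map_word, content_sortedWord] at h
  have key : ∑ i, ∑ j, A i j * ∑ s, ∑ t, A s t * comExpAbs (i, j) (s, t) = 4 * eExp n A := by
    have h1 : ∀ i j, ∑ s, ∑ t, A s t * comExpAbs (i, j) (s, t) =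
        2 * (∑ t, (if j ≠ t then A i t else 0) + ∑ s, (if i ≠ s then A s j else 0)) := by
      intro i j
      simp only [comExpAbs, mul_add, Finset.sum_add_distrib]
      congr 1
      · rw [Finset.sum_eq_single i, Finset.mul_sum]
        · refine Finset.sum_congr rfl fun t _ => ?_
          split_ifs <;> simp_all [mul_comm]
        · intro s _ hs
          simp [hs.symm]
        · simp
      · rw [Finset.sum_comm, Finset.sum_eq_single j, Finset.mul_sum]
        · refine Finset.sum_congr rfl fun t _ => ?_
          split_ifs <;> simp_all [mul_comm]
        · intro s _ hs
          simp [hs.symm]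
        · simp
    have h2 : ∀ i, ∑ j, A i j * ∑ t, (if j ≠ t then A i t else 0) =
        2 * ∑ j, ∑ k with k < j, A i j * A i k := fun i => sum_sum_ne _
    have h3 : ∀ j, ∑ i, A i j * ∑ s, (if i ≠ s then A s j else 0) =
        2 * ∑ i, ∑ k with k < i, A i j * A k j := fun j => sum_sum_ne fun i => A i j
    have h4 : ∑ i, ∑ j, A i j * ∑ s, (if i ≠ s then A s j else 0) =
        ∑ j, ∑ i, A i j * ∑ s, (if i ≠ s then A s j else 0) := Finset.sum_comm
    simp only [h1, mul_left_comm _ 2, mul_add, Finset.sum_add_distrib, ← Finset.mul_sum]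
    rw [h4]
    simp only [h2, h3, eExp, Finset.sum_add_distrib]
    simp only [← Finset.mul_sum]
    ring
  rw [key] at h
  push_cast at h
  linarith

end Words

section Straightening

open LaurentPolynomial

variable {n : ℕ} {S : Type*} [Ring S] {X : Fin n → Fin n → S}

/-- The product of a word in the generators. -/
def wordProd (X : Fin n → Fin n → S) (w : List (Fin n × Fin n)) : S :=
  (w.map fun p => X p.1 p.2).prod

theorem wordProd_cons (p : Fin n × Fin n) (w : List (Fin n × Fin n)) :
    wordProd X (p :: w) = X p.1 p.2 * wordProd X w := by
  simp [wordProd]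

theorem wordProd_sortedWord (X : Fin n → Fin n → S) (A : Mat n) :
    wordProd X (sortedWord A) = ((List.finRange n).map fun i =>
      ((List.finRange n).map fun j => X i j ^ A i j).prod).prod := by
  simp [wordProd, sortedWord, List.flatMap, List.map_flatten, List.prod_flatten,
    Function.comp_def]

variable [Algebra ℤ[T;T⁻¹] S]

/-- The span of the words of content lower than `A`. -/
def lowerWords (X : Fin n → Fin n → S) (A : Mat n) : Submodule ℤ[T;T⁻¹] S :=
  Submodule.span _ (wordProd X '' {w | matLT n (content w) A})

theorem wordProd_mem_lowerWords {A : Mat n} {w : List (Fin n × Fin n)}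
    (h : matLT n (content w) A) : wordProd X w ∈ lowerWords X A :=
  Submodule.subset_span ⟨w, h, rfl⟩

theorem mul_mem_lowerWords (p : Fin n × Fin n) {A : Mat n} {x : S} (hx : x ∈ lowerWords X A) :
    X p.1 p.2 * x ∈ lowerWords X (elem p + A) := by
  induction hx using Submodule.span_induction with
  | mem x h =>
    obtain ⟨w, hw, rfl⟩ := h
    rw [← wordProd_cons]
    apply wordProd_mem_lowerWords
    rw [content_cons]
    exact matLT.add_left _ hw
  | zero => simp
  | add x y _ _ hx hy => rw [mul_add]; exact add_mem hx hy
  | smul c x _ hx => rw [mul_smul_comm]; exact Submodule.smul_mem _ _ hx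

/-- Two words agree up to a power of `q` and words of lower content. -/
def WordRel (X : Fin n → Fin n → S) (w w' : List (Fin n × Fin n)) (k : ℤ) : Prop :=
  w.Perm w' ∧ wordProd X w - (T k : ℤ[T;T⁻¹]) • wordProd X w' ∈ lowerWords X (content w)

theorem WordRel.refl (w : List (Fin n × Fin n)) : WordRel X w w 0 :=
  ⟨List.Perm.refl _, by simp [T_zero]⟩

theorem WordRel.trans {w w' w'' : List (Fin n × Fin n)} {k l : ℤ} (h : WordRel X w w' k)
    (h' : WordRel X w' w'' l) : WordRel X w w'' (k + l) := by
  refine ⟨h.1.trans h'.1, ?_⟩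
  have := h'.2
  rw [← content_eq_iff.2 h.1] at this
  convert add_mem h.2 (Submodule.smul_mem _ (T k) this) using 1
  rw [T_add]
  module

theorem WordRel.cons (p : Fin n × Fin n) {w w' : List (Fin n × Fin n)} {k : ℤ}
    (h : WordRel X w w' k) : WordRel X (p :: w) (p :: w') k := by
  refine ⟨h.1.cons p, ?_⟩
  rw [content_cons, wordProd_cons, wordProd_cons, ← mul_smul_comm, ← mul_sub]
  exact mul_mem_lowerWords p h.2

theorem wordProd_diag_mem {i s j t : Fin n} (his : i < s) (hjt : j < t)
    (w : List (Fin n × Fin n)) :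
    X i t * X s j * wordProd X w ∈ lowerWords X (elem (i, j) + elem (s, t) + content w) := by
  have : X i t * X s j * wordProd X w = wordProd X ((i, t) :: (s, j) :: w) := by
    simp [wordProd_cons, mul_assoc]
  rw [this]
  apply wordProd_mem_lowerWords
  rw [content_cons, content_cons, ← add_assoc, add_comm _ (content w), add_comm _ (content w)]
  exact matLT.add_left _ (Relation.TransGen.single (matStep_elem his hjt))

theorem WordRel.swap
    (hX : IsQuad (T 2 : ℤ[T;T⁻¹]) (T (-2)) (fun i j s t => X i j * X s t))
    (p r : Fin n × Fin n) (w : List (Fin n × Fin n)) :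
    WordRel X (p :: r :: w) (r :: p :: w) (comExp p r) := by
  refine ⟨List.Perm.swap _ _ _, ?_⟩
  obtain ⟨i, j⟩ := p
  obtain ⟨s, t⟩ := r
  have hT : (T (-2) : ℤ[T;T⁻¹]) * T 2 = 1 := by rw [← T_add]; simp [T_zero]
  have sgn : ∀ {u v : Fin n}, u < v → (((v : ℕ) : ℤ) - (u : ℕ)).sign = 1 := by
    intro u v h
    have : u.val < v.val := h
    exact Int.sign_eq_one_of_pos (by omega)
  have sgn' : ∀ {u v : Fin n}, u < v → (((u : ℕ) : ℤ) - (v : ℕ)).sign = -1 := by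
    intro u v h
    have : u.val < v.val := h
    exact Int.sign_eq_neg_one_of_neg (by omega)
  simp only [content_cons, wordProd_cons, comExp, ← add_assoc, ← mul_assoc]
  rcases lt_trichotomy i s with h1 | rfl | h1 <;> rcases lt_trichotomy j t with h2 | rfl | h2
  · simp only [h1.ne, h2.ne, if_false, add_zero, mul_zero, T_zero, one_smul]
    rw [hX.diag i j s t h1 h2, add_mul, add_sub_cancel_left, smul_mul_assoc]
    exact Submodule.smul_mem _ _ (wordProd_diag_mem h1 h2 w)
  · rw [hX.col i s j h1]
    simp [h1.ne, sgn h1]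
  · rw [hX.anti s t i j h1 h2]
    simp [h1.ne, h2.ne', T_zero]
  · rw [hX.row i j t h2]
    simp [h2.ne, sgn h2]
  · simp [T_zero]
  · rw [hX.row i t j h2]
    simp [h2.ne', sgn' h2, smul_smul, hT]
  · rw [hX.anti i j s t h1 h2]
    simp [h1.ne', h2.ne, T_zero]
  · rw [hX.col s i j h1]
    simp [h1.ne', sgn' h1, smul_smul, hT]
  · simp only [h1.ne', h2.ne', if_false, add_zero, mul_zero, T_zero, one_smul]
    rw [hX.diag s t i j h1 h2, add_mul, sub_add_cancel_left, smul_mul_assoc,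
      add_comm (elem (i, j))]
    exact neg_mem (Submodule.smul_mem _ _ (wordProd_diag_mem h1 h2 w))

theorem exists_wordRel_of_perm
    (hX : IsQuad (T 2 : ℤ[T;T⁻¹]) (T (-2)) (fun i j s t => X i j * X s t))
    {w w' : List (Fin n × Fin n)} (h : w.Perm w') :
    ∃ k, WordRel X w w' k := by
  induction h with
  | nil => exact ⟨0, .refl _⟩
  | cons p _ ih =>
    obtain ⟨k, hk⟩ := ih
    exact ⟨k, hk.cons p⟩
  | swap p r w => exact ⟨_, .swap hX r p w⟩
  | trans _ _ ih ih' =>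
    obtain ⟨k, hk⟩ := ih
    obtain ⟨l, hl⟩ := ih'
    exact ⟨_, hk.trans hl⟩

theorem WordRel.move
    (hX : IsQuad (T 2 : ℤ[T;T⁻¹]) (T (-2)) (fun i j s t => X i j * X s t))
    (p : Fin n × Fin n) (w : List (Fin n × Fin n)) :
    WordRel X (p :: w) (w ++ [p]) (w.map (comExp p)).sum := by
  induction w with
  | nil => exact .refl _
  | cons r w ih =>
    rw [List.map_cons, List.sum_cons]
    exact (WordRel.swap hX p r w).trans (ih.cons r)

theorem WordRel.reverse
    (hX : IsQuad (T 2 : ℤ[T;T⁻¹]) (T (-2)) (fun i j s t => X i j * X s t))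
    (w : List (Fin n × Fin n)) : WordRel X w w.reverse (revExp w) := by
  induction w with
  | nil => exact .refl _
  | cons p w ih =>
    have := (ih.cons p).trans (WordRel.move hX p w.reverse)
    rw [List.map_reverse, List.sum_reverse, add_comm] at this
    rwa [List.reverse_cons, revExp]

/-- Straightening: a word is a combination of sorted words of at most the same content. -/
theorem wordProd_mem_span
    (hX : IsQuad (T 2 : ℤ[T;T⁻¹]) (T (-2)) (fun i j s t => X i j * X s t))
    (w : List (Fin n × Fin n)) :
    wordProd X w ∈ Submodule.span ℤ[T;T⁻¹] ((fun B => wordProd X (sortedWord B)) ''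
      {B | matLT n B (content w) ∨ B = content w}) := by
  induction h : content w using (wellFounded_matLT n).induction generalizing w with
  | _ A ih =>
  subst h
  obtain ⟨k, hk⟩ := exists_wordRel_of_perm hX
    (content_eq_iff.1 (content_sortedWord (content w)).symm)
  have h1 : wordProd X (sortedWord (content w)) ∈ Submodule.span ℤ[T;T⁻¹]
      ((fun B => wordProd X (sortedWord B)) '' {B | matLT n B (content w) ∨ B = content w}) :=
    Submodule.subset_span ⟨content w, Or.inr rfl, rfl⟩
  rw [← sub_add_cancel (wordProd X w) ((T k : ℤ[T;T⁻¹]) • wordProd X (sortedWord (content w)))]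
  refine add_mem ?_ (Submodule.smul_mem _ _ h1)
  refine Submodule.span_le.2 ?_ hk.2
  rintro _ ⟨w', hw', rfl⟩
  refine Submodule.span_mono (Set.image_mono ?_) (ih _ hw' w' rfl)
  rintro B (hB | rfl)
  · exact Or.inl (matLT.trans hB hw')
  · exact Or.inl hw'

theorem lowerWords_le
    (hX : IsQuad (T 2 : ℤ[T;T⁻¹]) (T (-2)) (fun i j s t => X i j * X s t))
    (A : Mat n) :
    lowerWords X A ≤ Submodule.span ℤ[T;T⁻¹] ((fun B => wordProd X (sortedWord B)) ''
      {B | matLT n B A}) := by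
  refine Submodule.span_le.2 ?_
  rintro _ ⟨w, hw, rfl⟩
  refine Submodule.span_mono (Set.image_mono ?_) (wordProd_mem_span hX w)
  rintro B (hB | rfl)
  · exact matLT.trans hB hw
  · exact hw

theorem wordProd_reverse_sub_mem
    (hX : IsQuad (T 2 : ℤ[T;T⁻¹]) (T (-2)) (fun i j s t => X i j * X s t))
    (A : Mat n) :
    wordProd X (sortedWord A).reverse - (T (-(2 * eExp n A)) : ℤ[T;T⁻¹]) •
      wordProd X (sortedWord A) ∈ Submodule.span ℤ[T;T⁻¹]
        ((fun B => wordProd X (sortedWord B)) '' {B | matLT n B A}) := by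
  apply lowerWords_le hX
  have h := (WordRel.reverse hX (sortedWord A)).2
  rw [content_sortedWord, revExp_sortedWord] at h
  have hT : (T (-(2 * eExp n A)) : ℤ[T;T⁻¹]) * T (2 * eExp n A) = 1 := by
    rw [← T_add]
    simp [T_zero]
  convert neg_mem (Submodule.smul_mem _ (T (-(2 * eExp n A))) h) using 1
  rw [smul_sub, smul_smul, hT, one_smul, neg_sub]

end Straightening

section KazhdanLusztig

open LaurentPolynomial

/-- A Laurent polynomial without terms of degree `≤ 0`. -/
def IsPos (r : ℤ[T;T⁻¹]) : Prop := ∀ k ≤ 0, r.coeff k = 0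

theorem IsPos.zero : IsPos 0 := fun k _ => by simp

theorem IsPos.add {r s : ℤ[T;T⁻¹]} (hr : IsPos r) (hs : IsPos s) : IsPos (r + s) := fun k hk => by
  simp [hr k hk, hs k hk]

theorem IsPos.neg {r : ℤ[T;T⁻¹]} (hr : IsPos r) : IsPos (-r) := fun k hk => by
  simp [hr k hk]

theorem IsPos.eq_zero {r : ℤ[T;T⁻¹]} (hr : IsPos r) (h : invert r = r) : r = 0 := by
  ext k
  rcases le_total k 0 with hk | hk
  · simp [hr k hk]
  · rw [← h, invert_apply, hr (-k) (by omega)]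
    simp

theorem exists_isPos_sub_invert {s : ℤ[T;T⁻¹]} (hs : invert s = -s) :
    ∃ t, IsPos t ∧ s = t - invert t := by
  refine ⟨AddMonoidAlgebra.ofCoeff (s.coeff.filter (0 < ·)), fun k hk => ?_, ?_⟩
  · simp [hk]
  · ext k
    have hk : s.coeff (-k) = - s.coeff k := by
      rw [← invert_apply, hs]
      simp
    rw [AddMonoidAlgebra.coeff_sub, Finsupp.sub_apply, invert_apply]
    simp only [Finsupp.filter_apply]
    rcases lt_trichotomy k 0 with h | rfl | h
    · simp [hk, h, h.le]
    · simp only [neg_zero] at hk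
      simp
      omega
    · simp [h, h.not_gt]

variable {ι M : Type*} [AddCommGroup M] [Module ℤ[T;T⁻¹] M]

/-- Combinations of the `x i`, `i ∈ s`, with coefficients of positive degree. -/
def posSpan (x : ι → M) (s : Set ι) : AddSubgroup M :=
  AddSubgroup.closure {m | ∃ i ∈ s, ∃ r : ℤ[T;T⁻¹], IsPos r ∧ m = r • x i}

theorem smul_mem_posSpan {x : ι → M} {s : Set ι} {i : ι} (hi : i ∈ s) {r : ℤ[T;T⁻¹]}
    (hr : IsPos r) : r • x i ∈ posSpan x s :=
  AddSubgroup.subset_closure ⟨i, hi, r, hr, rfl⟩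

theorem posSpan_mono (x : ι → M) {s t : Set ι} (h : s ⊆ t) : posSpan x s ≤ posSpan x t :=
  AddSubgroup.closure_mono fun _ ⟨i, hi, hr⟩ => ⟨i, h hi, hr⟩

theorem mem_span_of_mem_posSpan {x : ι → M} {s : Set ι} {m : M} (hm : m ∈ posSpan x s) :
    m ∈ Submodule.span ℤ[T;T⁻¹] (x '' s) := by
  have h : posSpan x s ≤ (Submodule.span ℤ[T;T⁻¹] (x '' s)).toAddSubgroup := by
    refine (AddSubgroup.closure_le _).2 ?_
    rintro _ ⟨i, hi, r, -, rfl⟩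
    exact Submodule.smul_mem _ _ (Submodule.subset_span ⟨i, hi, rfl⟩)
  exact h hm

theorem exists_of_mem_posSpan_insert {x : ι → M} {s : Set ι} {i : ι} {m : M}
    (hm : m ∈ posSpan x (insert i s)) :
    ∃ r, IsPos r ∧ ∃ m' ∈ posSpan x s, m = r • x i + m' := by
  induction hm using AddSubgroup.closure_induction with
  | mem m h =>
    obtain ⟨j, hj, r, hr, rfl⟩ := h
    rcases hj with rfl | hj
    · exact ⟨r, hr, 0, zero_mem _, by simp⟩
    · exact ⟨0, .zero, _, smul_mem_posSpan hj hr, by simp⟩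
  | zero => exact ⟨0, .zero, 0, zero_mem _, by simp⟩
  | add a b _ _ ha hb =>
    obtain ⟨r, hr, a', ha', rfl⟩ := ha
    obtain ⟨s, hs, b', hb', rfl⟩ := hb
    exact ⟨r + s, hr.add hs, a' + b', add_mem ha' hb', by module⟩
  | neg a _ ha =>
    obtain ⟨r, hr, a', ha', rfl⟩ := ha
    exact ⟨-r, hr.neg, -a', neg_mem ha', by module⟩

/-- A semilinear involution which is unitriangular on a linearly independent family. -/
structure IsTriangularBar (x : ι → M) (lt : ι → ι → Prop) (μ : ι → ℕ) (bar : M →+ M) : Prop where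
  linearIndependent : LinearIndependent ℤ[T;T⁻¹] x
  lt_trans : ∀ {i j k}, lt i j → lt j k → lt i k
  weight_lt : ∀ {i j}, lt i j → μ i < μ j
  finite_lt : ∀ i, {j | lt j i}.Finite
  bar_smul : ∀ (r : ℤ[T;T⁻¹]) (m : M), bar (r • m) = invert r • bar m
  bar_sub_mem : ∀ i, bar (x i) - x i ∈ Submodule.span ℤ[T;T⁻¹] (x '' {j | lt j i})
  bar_bar : ∀ i, bar (bar (x i)) = x i

namespace IsTriangularBar

variable {x : ι → M} {lt : ι → ι → Prop} {μ : ι → ℕ} {bar : M →+ M}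

theorem bar_bar_of_mem (h : IsTriangularBar x lt μ bar) {m : M}
    (hm : m ∈ Submodule.span ℤ[T;T⁻¹] (Set.range x)) : bar (bar m) = m := by
  induction hm using Submodule.span_induction with
  | mem m hm =>
    obtain ⟨i, rfl⟩ := hm
    exact h.bar_bar i
  | zero => simp
  | add a b _ _ ha hb => rw [map_add, map_add, ha, hb]
  | smul r a _ ha => rw [h.bar_smul, h.bar_smul, ha, involutive_invert r]

theorem bar_mem_span (h : IsTriangularBar x lt μ bar) {F : Set ι}
    (hF : ∀ i ∈ F, ∀ j, lt j i → j ∈ F) {m : M} (hm : m ∈ Submodule.span ℤ[T;T⁻¹] (x '' F)) :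
    bar m ∈ Submodule.span ℤ[T;T⁻¹] (x '' F) := by
  induction hm using Submodule.span_induction with
  | mem m hm =>
    obtain ⟨i, hi, rfl⟩ := hm
    have h1 := Submodule.span_mono (Set.image_mono (hF i hi)) (h.bar_sub_mem i)
    rw [← sub_add_cancel (bar (x i)) (x i)]
    exact add_mem h1 (Submodule.subset_span ⟨i, hi, rfl⟩)
  | zero => simp
  | add a b _ _ ha hb => rw [map_add]; exact add_mem ha hb
  | smul r a _ ha => rw [h.bar_smul]; exact Submodule.smul_mem _ _ ha

theorem coeff_eq_zero (h : IsTriangularBar x lt μ bar) {G : Set ι} {i : ι} (hi : i ∉ G)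
    {r : ℤ[T;T⁻¹]} (hr : r • x i ∈ Submodule.span ℤ[T;T⁻¹] (x '' G)) : r = 0 := by
  have hG : G ⊆ Set.univ \ {i} := fun j hj => ⟨trivial, by rintro rfl; exact hi hj⟩
  exact linearIndependent_iff_eq_zero_of_smul_mem_span.1 h.linearIndependent i r
    (Submodule.span_mono (Set.image_mono hG) hr)

/-- Removing an element of maximal weight from a lower set. -/
theorem exists_insert (h : IsTriangularBar x lt μ bar) {F : Finset ι} (hne : F.Nonempty)
    (hF : ∀ i ∈ F, ∀ j, lt j i → j ∈ F) :
    ∃ i, ∃ G ⊂ F, i ∉ G ∧ (F : Set ι) = insert i (G : Set ι) ∧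
      (∀ i ∈ G, ∀ j, lt j i → j ∈ G) ∧ {j | lt j i} ⊆ (G : Set ι) := by
  classical
  obtain ⟨i, hi, hmax⟩ := F.exists_max_image μ hne
  refine ⟨i, F.erase i, Finset.erase_ssubset hi, Finset.notMem_erase i F, ?_, ?_, ?_⟩
  · rw [← Finset.coe_insert, Finset.insert_erase hi]
  · intro j hj k hk
    have hj' := Finset.mem_of_mem_erase hj
    refine Finset.mem_erase.2 ⟨?_, hF j hj' k hk⟩
    rintro rfl
    exact absurd (h.weight_lt hk) (hmax j hj').not_gt
  · intro j hj
    refine Finset.mem_erase.2 ⟨?_, hF i hi j hj⟩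
    rintro rfl
    exact (h.weight_lt hj).false

theorem exists_eq_sub_bar (h : IsTriangularBar x lt μ bar) (F : Finset ι)
    (hF : ∀ i ∈ F, ∀ j, lt j i → j ∈ F) {d : M}
    (hd : d ∈ Submodule.span ℤ[T;T⁻¹] (x '' (F : Set ι))) (hbar : bar d = -d) :
    ∃ t ∈ posSpan x (F : Set ι), d = t - bar t := by
  induction F using Finset.strongInduction generalizing d with
  | H F ih =>
  rcases F.eq_empty_or_nonempty with rfl | hne
  · exact ⟨0, zero_mem _, by simpa using hd⟩
  obtain ⟨i, G, hG, hi, hFG, hGl, hlt⟩ := h.exists_insert hne hF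
  rw [hFG, Set.image_insert_eq] at hd
  obtain ⟨s, d', hd', rfl⟩ := Submodule.mem_span_insert.1 hd
  have hx := Submodule.span_mono (Set.image_mono hlt) (h.bar_sub_mem i)
  have hs : invert s = -s := by
    refine eq_neg_of_add_eq_zero_left (h.coeff_eq_zero hi (G := (G : Set ι)) ?_)
    rw [map_add, h.bar_smul] at hbar
    have : (invert s + s) • x i = -(d' + bar d' + invert s • (bar (x i) - x i)) := by
      rw [← sub_eq_zero] at hbar ⊢
      rw [← hbar]
      module
    rw [this]
    exact neg_mem (add_mem (add_mem hd' (h.bar_mem_span hGl hd')) (Submodule.smul_mem _ _ hx))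
  obtain ⟨t, ht, rfl⟩ := exists_isPos_sub_invert hs
  have hbb : bar (bar (t • x i)) = t • x i :=
    h.bar_bar_of_mem (Submodule.smul_mem _ _ (Submodule.subset_span ⟨i, rfl⟩))
  obtain ⟨u, hu, hu'⟩ := ih G hG hGl
    (d := (t - invert t) • x i + d' - (t • x i - bar (t • x i)))
    (by
      have : (t - invert t) • x i + d' - (t • x i - bar (t • x i)) =
          d' + invert t • (bar (x i) - x i) := by
        rw [h.bar_smul]
        module
      rw [this]
      exact add_mem hd' (Submodule.smul_mem _ _ hx))
    (by
      rw [map_sub, hbar, map_sub, hbb]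
      abel)
  refine ⟨t • x i + u, add_mem (smul_mem_posSpan (hFG ▸ Set.mem_insert _ _) ht)
    (posSpan_mono x (hFG ▸ Set.subset_insert _ _) hu), ?_⟩
  rw [map_add, ← sub_eq_zero]
  rw [← sub_eq_zero] at hu'
  rw [← hu']
  abel

theorem eq_zero_of_bar_eq (h : IsTriangularBar x lt μ bar) (F : Finset ι)
    (hF : ∀ i ∈ F, ∀ j, lt j i → j ∈ F) {d : M}
    (hd : d ∈ posSpan x (F : Set ι)) (hbar : bar d = d) : d = 0 := by
  induction F using Finset.strongInduction generalizing d with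
  | H F ih =>
  rcases F.eq_empty_or_nonempty with rfl | hne
  · simpa using mem_span_of_mem_posSpan hd
  obtain ⟨i, G, hG, hi, hFG, hGl, hlt⟩ := h.exists_insert hne hF
  rw [hFG] at hd
  obtain ⟨r, hr, d', hd', rfl⟩ := exists_of_mem_posSpan_insert hd
  have hx := Submodule.span_mono (Set.image_mono hlt) (h.bar_sub_mem i)
  have hd'' := mem_span_of_mem_posSpan hd'
  have hr0 : r = 0 := by
    refine hr.eq_zero (sub_eq_zero.1 (h.coeff_eq_zero hi (G := (G : Set ι)) ?_))
    rw [map_add, h.bar_smul] at hbar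
    have : (invert r - r) • x i = d' - bar d' - invert r • (bar (x i) - x i) := by
      rw [← sub_eq_zero] at hbar ⊢
      rw [← hbar]
      module
    rw [this]
    exact sub_mem (sub_mem hd'' (h.bar_mem_span hGl hd'')) (Submodule.smul_mem _ _ hx)
  subst hr0
  simp only [zero_smul, zero_add] at hbar ⊢
  exact ih G hG hGl hd' hbar

theorem exists_bar_eq (h : IsTriangularBar x lt μ bar) (i : ι) :
    ∃ b, bar b = b ∧ b - x i ∈ posSpan x {j | lt j i} := by
  have hL : ((h.finite_lt i).toFinset : Set ι) = {j | lt j i} := (h.finite_lt i).coe_toFinset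
  obtain ⟨t, ht, hd⟩ := h.exists_eq_sub_bar (h.finite_lt i).toFinset
    (by simpa using fun j hj k hk => h.lt_trans hk hj) (hL ▸ h.bar_sub_mem i)
    (by rw [map_sub, h.bar_bar]; abel)
  refine ⟨x i + t, ?_, ?_⟩
  · rw [map_add, ← sub_eq_zero]
    rw [← sub_eq_zero] at hd
    rw [← hd]
    abel
  · rw [hL] at ht
    simpa using ht

theorem eq_of_bar_eq (h : IsTriangularBar x lt μ bar) {i : ι} {b b' : M} (hb : bar b = b)
    (hb' : bar b' = b') (hx : b - x i ∈ posSpan x {j | lt j i})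
    (hx' : b' - x i ∈ posSpan x {j | lt j i}) : b = b' := by
  refine sub_eq_zero.1 (h.eq_zero_of_bar_eq (h.finite_lt i).toFinset
    (by simpa using fun j hj k hk => h.lt_trans hk hj) ?_ (by rw [map_sub, hb, hb']))
  rw [(h.finite_lt i).coe_toFinset, ← sub_sub_sub_cancel_right b b' (x i)]
  exact sub_mem hx hx'

end IsTriangularBar

end KazhdanLusztig

section QuantumMatrices

open LaurentPolynomial

instance : Algebra ℤ[T;T⁻¹] Kq :=
  (LaurentPolynomial.eval₂ (Int.castRingHom Kq) (Units.mk0 qq qq_ne_zero)).toAlgebra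

theorem algebraMap_T (k : ℤ) : algebraMap ℤ[T;T⁻¹] Kq (T k) = qq ^ k := by
  simp [RingHom.algebraMap_toAlgebra]

theorem algebraMap_C (a : ℤ) : algebraMap ℤ[T;T⁻¹] Kq (C a) = a := by
  simp [RingHom.algebraMap_toAlgebra]

theorem algebraMap_toLaurent (p : Polynomial ℤ) :
    algebraMap ℤ[T;T⁻¹] Kq (Polynomial.toLaurent p) = Polynomial.aeval qq p := by
  rw [RingHom.algebraMap_toAlgebra, LaurentPolynomial.eval₂_toLaurent, Polynomial.aeval_def,
    RingHom.ext_int (Int.castRingHom Kq) (algebraMap ℤ Kq)]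
  rfl

theorem aeval_qq_injective : Function.Injective (Polynomial.aeval (R := ℤ) qq) := by
  intro p p' h
  have key : ∀ p : Polynomial ℤ, Polynomial.aeval qq p =
      algebraMap (Polynomial ℚ) Kq (p.map (Int.castRingHom ℚ)) := fun p => by
    induction p using Polynomial.induction_on' with
    | add p q hp hq => simp [hp, hq]
    | monomial n a => simp [← Polynomial.C_mul_X_pow_eq_monomial, qq]
  rw [key, key] at h
  exact Polynomial.map_injective _ Int.cast_injective (RatFunc.algebraMap_injective ℚ h)

theorem algebraMap_laurent_injective : Function.Injective (algebraMap ℤ[T;T⁻¹] Kq) := by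
  refine (injective_iff_map_eq_zero _).2 fun f hf => ?_
  obtain ⟨m, p, hp⟩ := f.exists_T_pow
  have h : Polynomial.aeval qq p = Polynomial.aeval qq (0 : Polynomial ℤ) := by
    rw [← algebraMap_toLaurent, hp, map_mul, hf, zero_mul, map_zero]
  rw [aeval_qq_injective h, map_zero] at hp
  have : f * T m * T (-m) = f := by
    rw [mul_assoc, ← T_add]
    simp [T_zero]
  rw [← this, ← hp, zero_mul]

theorem inQZq.add {c d : Kq} (hc : inQZq c) (hd : inQZq d) : inQZq (c + d) := by
  obtain ⟨c, hc, rfl⟩ := hc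
  obtain ⟨d, hd, rfl⟩ := hd
  exact ⟨c + d, add_mem (S := Subring Kq) hc hd, by ring⟩

theorem inQZq.neg {c : Kq} (hc : inQZq c) : inQZq (-c) := by
  obtain ⟨c, hc, rfl⟩ := hc
  exact ⟨-c, neg_mem (S := Subring Kq) hc, by ring⟩

theorem inQZq.zero : inQZq 0 := ⟨0, zero_mem (Subring.closure ({qq} : Set Kq)), by simp⟩

theorem inQZq.inZq {c : Kq} (hc : inQZq c) : inZq c := by
  obtain ⟨c, hc, rfl⟩ := hc
  exact mul_mem (S := Subring Kq) (Subring.subset_closure (Set.mem_singleton _)) hc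

theorem inQZq_intCast_mul_zpow (a : ℤ) {k : ℤ} (hk : 0 < k) : inQZq (a * qq ^ k) := by
  obtain ⟨m, rfl⟩ : ∃ m : ℕ, k = m + 1 := ⟨(k - 1).toNat, by omega⟩
  have hm : (a : Kq) * qq ^ m ∈ Subring.closure ({qq} : Set Kq) :=
    Subring.mul_mem _ (intCast_mem _ _) (Subring.pow_mem _ (Subring.subset_closure (Set.mem_singleton _)) m)
  refine ⟨_, hm, ?_⟩
  rw [zpow_add₀ qq_ne_zero, zpow_natCast, zpow_one, ← mul_assoc, mul_comm]

theorem IsPos.inQZq_algebraMap {r : ℤ[T;T⁻¹]} (hr : IsPos r) :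
    inQZq (algebraMap ℤ[T;T⁻¹] Kq r) := by
  have hsum : r = ∑ k ∈ r.coeff.support, C (r.coeff k) * T k :=
    (AddMonoidAlgebra.sum_coeff_single r).symm.trans
      (Finset.sum_congr rfl fun k _ => single_eq_C_mul_T _ _)
  rw [hsum, map_sum]
  refine Finset.sum_induction _ inQZq (fun _ _ => inQZq.add) inQZq.zero fun k hk => ?_
  have hk0 : 0 < k := by
    by_contra! h
    exact Finsupp.mem_support_iff.1 hk (hr k h)
  rw [map_mul, algebraMap_C, algebraMap_T]
  exact inQZq_intCast_mul_zpow _ hk0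

theorem inQZq.exists_isPos {c : Kq} (hc : inQZq c) :
    ∃ r, IsPos r ∧ algebraMap ℤ[T;T⁻¹] Kq r = c := by
  obtain ⟨d, hd, rfl⟩ := hc
  have hle : Subring.closure ({qq} : Set Kq) ≤ (Polynomial.aeval (R := ℤ) qq).toRingHom.range := by
    rw [Subring.closure_le, Set.singleton_subset_iff]
    exact ⟨Polynomial.X, by simp⟩
  obtain ⟨p, hp⟩ := hle hd
  refine ⟨T 1 * Polynomial.toLaurent p, ?_, ?_⟩
  · clear hp
    induction p using Polynomial.induction_on' with
    | add p p' hp hp' =>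
      rw [map_add, mul_add]
      exact hp.add hp'
    | monomial m a =>
      intro k hk
      rw [← Polynomial.C_mul_X_pow_eq_monomial, Polynomial.toLaurent_C_mul_X_pow, mul_left_comm,
        ← T_add, ← single_eq_C_mul_T, AddMonoidAlgebra.coeff_single,
        Finsupp.single_apply, if_neg (by omega)]
  · rw [map_mul, algebraMap_T, algebraMap_toLaurent, zpow_one]
    exact congrArg _ hp

variable {n : ℕ}

theorem mem_posSpan_iff (x : Mat n → Oq n) (L : Finset (Mat n)) (m : Oq n) :
    m ∈ posSpan x (L : Set (Mat n)) ↔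
      ∃ h : Mat n → Kq, (∀ B ∈ L, inQZq (h B)) ∧ m = ∑ B ∈ L, h B • x B := by
  classical
  constructor
  · intro hm
    induction hm using AddSubgroup.closure_induction with
    | mem m hm =>
      obtain ⟨i, hi, r, hr, rfl⟩ := hm
      refine ⟨Pi.single i (algebraMap _ _ r), fun B _ => ?_, ?_⟩
      · rcases eq_or_ne B i with rfl | hB
        · simpa using hr.inQZq_algebraMap
        · simpa [hB] using inQZq.zero
      · rw [Finset.sum_eq_single_of_mem i hi (fun B _ hB => by simp [hB]), Pi.single_eq_same,
          algebraMap_smul]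
    | zero => exact ⟨0, fun _ _ => inQZq.zero, by simp⟩
    | add a b _ _ ha hb =>
      obtain ⟨h, hh, rfl⟩ := ha
      obtain ⟨h', hh', rfl⟩ := hb
      exact ⟨h + h', fun B hB => (hh B hB).add (hh' B hB), by
        simp [add_smul, Finset.sum_add_distrib]⟩
    | neg a _ ha =>
      obtain ⟨h, hh, rfl⟩ := ha
      exact ⟨-h, fun B hB => (hh B hB).neg, by
        rw [← Finset.sum_neg_distrib]
        exact Finset.sum_congr rfl fun B _ => (neg_smul (h B) (x B)).symm⟩
  · rintro ⟨h, hh, rfl⟩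
    refine sum_mem fun B hB => ?_
    obtain ⟨r, hr, hrh⟩ := (hh B hB).exists_isPos
    rw [← hrh, algebraMap_smul]
    exact smul_mem_posSpan hB hr

theorem exists_sum_iff_sub_mem_posSpan (x : Mat n → Oq n) (A : Mat n) (b : Oq n) :
    (∃ (F : Finset (Mat n)) (h : Mat n → Kq), (∀ B ∈ F, matLT n B A ∧ inQZq (h B)) ∧
      b = x A + ∑ B ∈ F, h B • x B) ↔ b - x A ∈ posSpan x {B | matLT n B A} := by
  constructor
  · rintro ⟨F, h, hF, rfl⟩
    rw [add_sub_cancel_left]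
    exact posSpan_mono x (fun B hB => (hF B hB).1)
      ((mem_posSpan_iff x F _).2 ⟨h, fun B hB => (hF B hB).2, rfl⟩)
  · intro hb
    rw [← (finite_matLT A).coe_toFinset, mem_posSpan_iff] at hb
    obtain ⟨h, hh, hb⟩ := hb
    refine ⟨_, h, fun B hB => ⟨by simpa using hB, hh B hB⟩, ?_⟩
    rw [← hb, add_sub_cancel]

theorem xgen_isQuad (n : ℕ) : IsQuad (T 2 : ℤ[T;T⁻¹]) (T (-2))
    (fun i j s t => xgen n i j * xgen n s t) where
  row i j l h := by
    rw [← algebraMap_smul Kq, algebraMap_T]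
    simpa [xgen] using RingQuot.mkAlgHom_rel Kq (OqRel.rel_row (i := i) h)
  col i s j h := by
    rw [← algebraMap_smul Kq, algebraMap_T]
    simpa [xgen] using RingQuot.mkAlgHom_rel Kq (OqRel.rel_col (j := j) h)
  anti i j s t h1 h2 := by
    simpa [xgen] using RingQuot.mkAlgHom_rel Kq (OqRel.rel_anti h1 h2)
  diag i j s t h1 h2 := by
    rw [← algebraMap_smul Kq, map_sub, algebraMap_T, algebraMap_T]
    simpa [xgen, zpow_neg] using RingQuot.mkAlgHom_rel Kq (OqRel.rel_diag h1 h2)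

theorem xMod_eq_smul_wordProd (A : Mat n) :
    xMod n A = (T (-(eExp n A : ℤ)) : ℤ[T;T⁻¹]) • wordProd (xgen n) (sortedWord A) := by
  rw [← algebraMap_smul Kq, algebraMap_T, wordProd_sortedWord]
  rfl

theorem span_wordProd_le (s : Set (Mat n)) :
    Submodule.span ℤ[T;T⁻¹] ((fun B => wordProd (xgen n) (sortedWord B)) '' s) ≤
      Submodule.span ℤ[T;T⁻¹] (xMod n '' s) := by
  refine Submodule.span_le.2 ?_
  rintro _ ⟨A, hA, rfl⟩
  have h : wordProd (xgen n) (sortedWord A) = (T (eExp n A : ℤ) : ℤ[T;T⁻¹]) • xMod n A := by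
    rw [xMod_eq_smul_wordProd, smul_smul, ← T_add]
    simp [T_zero]
  simp only [h]
  exact Submodule.smul_mem _ _ (Submodule.subset_span ⟨A, hA, rfl⟩)

theorem linearIndependent_laurent_xMod (n : ℕ) : LinearIndependent ℤ[T;T⁻¹] (xMod n) := by
  refine (linearIndependent_xMod n).restrict_scalars ?_
  simpa [Algebra.smul_def] using algebraMap_laurent_injective

namespace IsBar

variable {bar : Oq n → Oq n}

theorem map_wordProd (h : IsBar n bar) (w : List (Fin n × Fin n)) :
    bar (wordProd (xgen n) w) = wordProd (xgen n) w.reverse := by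
  obtain ⟨-, -, -, hmul, hone, hgen, -⟩ := h
  induction w with
  | nil => simpa [wordProd] using hone
  | cons p w ih =>
    rw [wordProd_cons, hmul, ih, hgen]
    simp [wordProd]

theorem map_smul (h : IsBar n bar) (r : ℤ[T;T⁻¹]) (m : Oq n) :
    bar (r • m) = invert r • bar m := by
  obtain ⟨-, hadd, -, -, -, -, hq⟩ := h
  let φ : Oq n →+ Oq n := AddMonoidHom.mk' bar hadd
  have hpow : ∀ (k : ℕ) (m : Oq n), bar (qq ^ k • m) = (qq⁻¹) ^ k • bar m := fun k => by
    induction k with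
    | zero => simp
    | succ k ih => exact fun m => by rw [pow_succ, mul_smul, ih, hq, smul_smul, ← pow_succ]
  have hzpow : ∀ (k : ℤ) (m : Oq n), bar (qq ^ k • m) = qq ^ (-k) • bar m := fun k m => by
    rcases le_total 0 k with hk | hk
    · lift k to ℕ using hk
      rw [zpow_natCast, hpow, inv_pow, zpow_neg, zpow_natCast]
    · obtain ⟨j, rfl⟩ := Int.exists_eq_neg_ofNat hk
      have := hpow j (qq ^ (-(j : ℤ)) • m)
      rw [smul_smul, zpow_neg, zpow_natCast, mul_inv_cancel₀ (pow_ne_zero _ qq_ne_zero),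
        one_smul] at this
      rw [this, smul_smul, neg_neg, zpow_neg, zpow_natCast, inv_pow,
        mul_inv_cancel₀ (pow_ne_zero _ qq_ne_zero), one_smul]
  induction r using LaurentPolynomial.induction_on' with
  | add p p' hp hp' => rw [add_smul, hadd, hp, hp', map_add, add_smul]
  | C_mul_T k a =>
    have hC : ∀ m : Oq n, (C a : ℤ[T;T⁻¹]) • m = a • m := fun m => by
      rw [← algebraMap_smul Kq, algebraMap_C, Int.cast_smul_eq_zsmul]
    have hT : ∀ (k : ℤ) (m : Oq n), (T k : ℤ[T;T⁻¹]) • m = qq ^ k • m := fun k m => by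
      rw [← algebraMap_smul Kq, algebraMap_T]
    rw [map_mul, invert_C, invert_T, mul_smul, mul_smul, hC, hC, hT, hT, ← hzpow]
    exact map_zsmul φ a _

theorem isTriangularBar (h : IsBar n bar) :
    IsTriangularBar (xMod n) (matLT n) (matWeight fun i j => i.val * j.val)
      (AddMonoidHom.mk' bar h.2.1) where
  linearIndependent := linearIndependent_laurent_xMod n
  lt_trans := matLT.trans
  weight_lt := matLT.weight_lt
  finite_lt := finite_matLT
  bar_smul := h.map_smul
  bar_sub_mem A := by
    refine span_wordProd_le _ ?_
    convert Submodule.smul_mem _ (T (eExp n A)) (wordProd_reverse_sub_mem (xgen_isQuad n) A) using 1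
    rw [AddMonoidHom.mk'_apply, xMod_eq_smul_wordProd, h.map_smul, h.map_wordProd, invert_T,
      smul_sub, smul_smul, ← T_add, neg_neg]
    congr 4
    ring
  bar_bar A := by
    rw [AddMonoidHom.mk'_apply, xMod_eq_smul_wordProd, h.map_smul,
      h.map_wordProd, h.map_smul, h.map_wordProd, invert_T, invert_T, List.reverse_reverse, neg_neg]

end IsBar

section Unitriangular

variable {b : Mat n → Oq n}

theorem xMod_mem_span (hb : ∀ A, b A - xMod n A ∈ posSpan (xMod n) {B | matLT n B A})
    (A : Mat n) : xMod n A ∈ Submodule.span (Subring.closure ({qq} : Set Kq)) (Set.range b) := by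
  induction A using (wellFounded_matLT n).induction with
  | _ A ih =>
  obtain ⟨F, h, hF, hbA⟩ := (exists_sum_iff_sub_mem_posSpan _ A _).2 (hb A)
  rw [eq_sub_of_add_eq hbA.symm]
  refine sub_mem (Submodule.subset_span ⟨A, rfl⟩) (sum_mem fun B hB => ?_)
  exact Submodule.smul_mem _ (⟨h B, (hF B hB).2.inZq⟩ : Subring.closure ({qq} : Set Kq))
    (ih B (hF B hB).1)

theorem exists_sum_of_memLstar
    (hb : ∀ A, b A - xMod n A ∈ posSpan (xMod n) {B | matLT n B A}) {v : Oq n}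
    (hv : memLstar n v) : ∃ (F : Finset (Mat n)) (h : Mat n → Kq),
      (∀ A ∈ F, inZq (h A)) ∧ v = ∑ A ∈ F, h A • b A := by
  obtain ⟨F, h, hF, rfl⟩ := hv
  have hmem : ∑ A ∈ F, h A • xMod n A ∈
      Submodule.span (Subring.closure ({qq} : Set Kq)) (Set.range b) :=
    sum_mem fun A hA => Submodule.smul_mem _
      (⟨h A, hF A hA⟩ : Subring.closure ({qq} : Set Kq)) (xMod_mem_span hb A)
  obtain ⟨c, hc⟩ := Finsupp.mem_span_range_iff_exists_finsupp.1 hmem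
  exact ⟨c.support, fun A => c A, fun A _ => (c A).2, hc.symm⟩

theorem linearIndependent_of_sub_mem_posSpan
    (hb : ∀ A, b A - xMod n A ∈ posSpan (xMod n) {B | matLT n B A}) :
    LinearIndependent Kq b := by
  classical
  let μ : Mat n → ℕ := matWeight fun i j => i.val * j.val
  have hsub : ∀ A, b A - xMod n A ∈ Submodule.span Kq (xMod n '' {B | μ B < μ A}) := fun A => by
    obtain ⟨F, h, hF, hbA⟩ := (exists_sum_iff_sub_mem_posSpan _ A _).2 (hb A)
    rw [hbA, add_sub_cancel_left]
    exact sum_mem fun B hB => Submodule.smul_mem _ _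
      (Submodule.subset_span ⟨B, (hF B hB).1.weight_lt, rfl⟩)
  refine linearIndependent_iff'.2 fun F h hsum => ?_
  by_contra! hne
  obtain ⟨A₀, hA₀, hA₀'⟩ := hne
  obtain ⟨A, hA, hmax⟩ := (F.filter (h · ≠ 0)).exists_max_image μ ⟨A₀, by simp [hA₀, hA₀']⟩
  rw [Finset.mem_filter] at hA
  refine hA.2 (linearIndependent_iff_eq_zero_of_smul_mem_span.1 (linearIndependent_xMod n) A _ ?_)
  have hne : ∀ B, μ B ≤ μ A → xMod n '' {C | μ C < μ B} ⊆ xMod n '' (Set.univ \ {A}) := by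
    refine fun B hB => Set.image_mono fun C hC => ⟨trivial, ?_⟩
    rintro rfl
    exact (lt_of_lt_of_le hC hB).false
  have hrest : ∑ B ∈ F.erase A, h B • b B ∈ Submodule.span Kq (xMod n '' (Set.univ \ {A})) := by
    refine sum_mem fun B hB => ?_
    by_cases hB0 : h B = 0
    · simp [hB0]
    rw [Finset.mem_erase] at hB
    refine Submodule.smul_mem _ _ ?_
    rw [← sub_add_cancel (b B) (xMod n B)]
    exact add_mem (Submodule.span_mono (hne B (hmax B (by simp [hB.2, hB0]))) (hsub B))
      (Submodule.subset_span ⟨B, ⟨trivial, hB.1⟩, rfl⟩)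
  rw [← Finset.add_sum_erase F _ hA.1] at hsum
  have : h A • xMod n A = -(h A • (b A - xMod n A)) - ∑ B ∈ F.erase A, h B • b B := by
    rw [eq_neg_of_add_eq_zero_right hsum, smul_sub]
    abel
  rw [this]
  exact sub_mem (neg_mem (Submodule.smul_mem _ _ (Submodule.span_mono (hne A le_rfl) (hsub A))))
    hrest

end Unitriangular

end QuantumMatrices

/-- There is a unique basis `B* = {b(A)}` of the `ℤ[q]`-module `L*` such
that every `b(A)` is bar-invariant and `b(A) = x(A) + Σ_{B<A} h_{BA} x(B)` with
`h_{BA} ∈ qℤ[q]`. -/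
theorem dual_canonical_basis_exists_unique (n : ℕ) (bar : Oq n → Oq n)
    (hbar : IsBar n bar) :
    ∃! b : Mat n → Oq n, IsDCB n bar b := by
  simp only [IsDCB, exists_sum_iff_sub_mem_posSpan]
  have h := hbar.isTriangularBar
  choose b hb hbx using h.exists_bar_eq
  refine ⟨b, ⟨hb, hbx, fun v => exists_sum_of_memLstar hbx, fun F g _ hF =>
    linearIndependent_iff'.1 (linearIndependent_of_sub_mem_posSpan hbx) F g hF⟩, ?_⟩
  rintro b' ⟨hb', hbx', -, -⟩
  exact funext fun A => h.eq_of_bar_eq (hb' A) (hb A) (hbx' A) (hbx A)
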